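/- arXiv:1302.1797 — 3 statements merged into one kernel-verified Lean document; each statement's English description precedes it below -/
import Mathlib

section
/- Let f : [0,∞) → ℝ be nonnegative, nondecreasing and concave. Then for every p > 0 the Laplace transform integral f̃(p) = ∫₀^∞ e^{−pt} f(t) dt converges, and the function g : (0,∞) → ℝ defined by g(p) = p² f̃(p) is a Bernstein function on (0,∞): g is nonnegative, infinitely differentiable, and (−1)^{n−1} g⁽ⁿ⁾(p) ≥ 0 for all p > 0 and all integers n ≥ 1. -/
open MeasureTheory Set Filter

/-- A nonnegative concave function lies above its chord through `a` and `b` between these points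
and below it elsewhere, and the chord has a nonnegative intercept. -/
lemma ConcaveOn.exists_chord {f : ℝ → ℝ} (hf : ConcaveOn ℝ (Ici 0) f)
    (hnn : ∀ t : ℝ, 0 ≤ t → 0 ≤ f t) {a b : ℝ} (ha : 0 ≤ a) (hab : a < b) :
    ∃ A B : ℝ, 0 ≤ A ∧ ∀ t : ℝ, 0 ≤ t → (t - a) * (t - b) * (f t - (A + B * t)) ≤ 0 := by
  have three {x y z : ℝ} (hx : 0 ≤ x) (hxy : x < y) (hyz : y < z) :
      (z - y) * f x + (y - x) * f z ≤ (z - x) * f y := by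
    have h := hf.neg.secant_mono_aux1 (x := x) (y := y) (z := z) hx
      (hx.trans (hxy.trans hyz).le) hxy hyz
    simp only [Pi.neg_apply] at h
    linarith
  have hd : 0 < b - a := sub_pos.2 hab
  set B := (f b - f a) / (b - a) with hB
  have hBd : B * (b - a) = f b - f a := div_mul_cancel₀ _ hd.ne'
  have below {t : ℝ} (h : (b - a) * f t ≤ (b - a) * (f a + B * (t - a))) :
      f t ≤ f a + B * (t - a) := le_of_mul_le_mul_left h hd
  refine ⟨f a - B * a, B, ?_, fun t ht => ?_⟩
  · rcases ha.eq_or_lt with rfl | ha'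
    · simpa using hnn 0 le_rfl
    · have h3 := three le_rfl ha' hab
      have := below (t := 0) (by linear_combination h3 + a * hBd)
      linarith [hnn 0 le_rfl]
  · rcases lt_trichotomy t a with h | rfl | h
    · have h3 := three ht h hab
      have := below (t := t) (by linear_combination h3 + (a - t) * hBd)
      exact mul_nonpos_of_nonneg_of_nonpos
        (mul_nonneg_of_nonpos_of_nonpos (by linarith) (by linarith)) (by linarith)
    · simp
    · rcases lt_trichotomy t b with h' | rfl | h'
      · have h3 := three ha h h'
        have : f a + B * (t - a) ≤ f t := by
          refine le_of_mul_le_mul_left ?_ hd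
          linear_combination h3 + (t - a) * hBd
        exact mul_nonpos_of_nonpos_of_nonneg
          (mul_nonpos_of_nonneg_of_nonpos (by linarith) (by linarith)) (by linarith)
      · simp
      · have h3 := three ha hab h'
        have := below (t := t) (by linear_combination h3 - (t - a) * hBd)
        exact mul_nonpos_of_nonneg_of_nonpos
          (mul_nonneg (by linarith) (by linarith)) (by linarith)

lemma integrableOn_exp_neg_mul_mul_pow {p : ℝ} (hp : 0 < p) (n : ℕ) :
    IntegrableOn (fun t : ℝ => Real.exp (-p * t) * t ^ n) (Ioi 0) := by
  have h := integrableOn_rpow_mul_exp_neg_mul_rpow (s := n) (p := 1) (b := p)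
    (by have := n.cast_nonneg (α := ℝ); linarith) one_pos hp
  simpa [mul_comm] using h

lemma integral_exp_neg_mul_mul_pow {p : ℝ} (hp : 0 < p) (n : ℕ) :
    ∫ t in Ioi (0 : ℝ), Real.exp (-p * t) * t ^ n = n.factorial / p ^ (n + 1) := by
  have h := Real.integral_rpow_mul_exp_neg_mul_Ioi (a := n + 1) (by positivity) hp
  rw [Real.Gamma_nat_eq_factorial, ← Nat.cast_succ, Real.rpow_natCast] at h
  simp only [Nat.cast_succ, add_sub_cancel_right, Real.rpow_natCast] at h
  simp only [neg_mul, mul_comm (Real.exp _), h]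
  simp [div_eq_inv_mul]

section Laplace

variable {f : ℝ → ℝ}

/-- Moments of a Laplace transform converge and are differentiable under the integral sign. -/
lemma laplace_moment_integrableOn_and_hasDerivAt
    (hmeas : AEMeasurable f (volume.restrict (Ioi 0))) (hnn : ∀ t : ℝ, 0 < t → 0 ≤ f t)
    (hf_int : ∀ p : ℝ, 0 < p → IntegrableOn (fun t => Real.exp (-p * t) * f t) (Ioi 0))
    {p : ℝ} (hp : 0 < p) (n : ℕ) :
    IntegrableOn (fun t => Real.exp (-p * t) * t ^ n * f t) (Ioi 0) ∧
    HasDerivAt (fun q => ∫ t in Ioi (0 : ℝ), Real.exp (-q * t) * t ^ n * f t)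
      (-∫ t in Ioi (0 : ℝ), Real.exp (-p * t) * t ^ (n + 1) * f t) p := by
  have hmeas' : AEMeasurable (fun t => (f t).toNNReal) (volume.restrict (Ioi 0)) :=
    hmeas.real_toNNReal
  set μ : Measure ℝ := (volume.restrict (Ioi 0)).withDensity (fun t => (f t).toNNReal) with hμ
  have smul_eq (g : ℝ → ℝ) : (fun t => (f t).toNNReal • g t) =ᵐ[volume.restrict (Ioi 0)]
      fun t => g t * f t := by
    filter_upwards [ae_restrict_mem measurableSet_Ioi] with t ht
    rw [NNReal.smul_def, Real.coe_toNNReal _ (hnn t ht), smul_eq_mul, mul_comm]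
  have integrable_iff (g : ℝ → ℝ) : Integrable g μ ↔ IntegrableOn (fun t => g t * f t) (Ioi 0) := by
    rw [hμ, integrable_withDensity_iff_integrable_smul₀ hmeas', integrable_congr (smul_eq g)]
    rfl
  have integral_eq (g : ℝ → ℝ) : ∫ t, g t ∂μ = ∫ t in Ioi 0, g t * f t := by
    rw [hμ, integral_withDensity_eq_integral_smul₀ hmeas', integral_congr_ae (smul_eq g)]
  have hmem : p ∈ interior (ProbabilityTheory.integrableExpSet (fun t : ℝ => -t) μ) := by
    refine interior_mono (s := Ioi 0) (fun q hq => ?_) (by rwa [interior_Ioi])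
    refine (integrable_iff _).2 ?_
    simpa using hf_int q hq
  have kernel_eq (k : ℕ) (q t : ℝ) :
      (-t) ^ k * Real.exp (q * -t) = (-1) ^ k * (Real.exp (-q * t) * t ^ k) := by
    rw [neg_pow, neg_mul, mul_neg]
    ring
  have sq (k : ℕ) : ((-1 : ℝ)) ^ k * (-1) ^ k = 1 := by
    rw [← mul_pow]; simp
  constructor
  · have h := ProbabilityTheory.integrable_pow_mul_exp_of_mem_interior_integrableExpSet hmem n
    simp only [kernel_eq] at h
    have h2 := ((integrable_iff _).1 (h.const_mul ((-1) ^ n)))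
    simpa only [← mul_assoc, sq, one_mul] using h2
  · have h := ProbabilityTheory.hasDerivAt_integral_pow_mul_exp_real hmem n
    simp only [kernel_eq, integral_eq, mul_assoc, integral_const_mul] at h
    have h2 := h.const_mul ((-1) ^ n)
    simp only [← mul_assoc, pow_succ _ n, sq, one_mul, neg_mul] at h2 ⊢
    exact h2

end Laplace

lemma iteratedDerivWithin_sq_mul {F : ℕ → ℝ → ℝ}
    (hF : ∀ n p, 0 < p → HasDerivAt (F n) (-F (n + 1) p) p) (n : ℕ) {p : ℝ} (hp : 0 < p) :
    iteratedDerivWithin n (fun q => q ^ 2 * F 0 q) (Ioi 0) p =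
      (-1) ^ n * (p ^ 2 * F n p - 2 * n * p * F (n - 1) p + n * (n - 1) * F (n - 2) p) := by
  induction n generalizing p with
  | zero => simp
  | succ n ih =>
    have hcongr : EqOn (iteratedDerivWithin n (fun q => q ^ 2 * F 0 q) (Ioi 0)) (fun q =>
        (-1) ^ n * (q ^ 2 * F n q - 2 * n * q * F (n - 1) q + n * (n - 1) * F (n - 2) q))
        (Ioi 0) := fun q hq => ih hq
    rw [iteratedDerivWithin_succ, derivWithin_congr hcongr (hcongr hp),
      derivWithin_of_isOpen isOpen_Ioi hp]
    have h := ((((hasDerivAt_id p).pow 2).mul (hF n p hp)).sub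
      (((hasDerivAt_id p).const_mul (2 * (n : ℝ))).mul (hF (n - 1) p hp))).add
      ((hF (n - 2) p hp).const_mul ((n : ℝ) * (n - 1))) |>.const_mul ((-1 : ℝ) ^ n)
    refine HasDerivAt.deriv (h.congr_deriv ?_)
    rcases n with _ | _ | n <;> simp <;> ring

lemma integral_deriv_deriv_kernel_mul {h : ℝ → ℝ} {p : ℝ}
    (hh : ∀ k : ℕ, IntegrableOn (fun t => Real.exp (-p * t) * t ^ k * h t) (Ioi 0)) (n : ℕ) :
    IntegrableOn (fun t => p ^ 2 * (Real.exp (-p * t) * t ^ n * h t)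
        - 2 * n * p * (Real.exp (-p * t) * t ^ (n - 1) * h t)
        + n * (n - 1) * (Real.exp (-p * t) * t ^ (n - 2) * h t)) (Ioi 0) ∧
    ∫ t in Ioi (0 : ℝ), (p ^ 2 * (Real.exp (-p * t) * t ^ n * h t)
        - 2 * n * p * (Real.exp (-p * t) * t ^ (n - 1) * h t)
        + n * (n - 1) * (Real.exp (-p * t) * t ^ (n - 2) * h t)) =
      p ^ 2 * (∫ t in Ioi (0 : ℝ), Real.exp (-p * t) * t ^ n * h t)
        - 2 * n * p * (∫ t in Ioi (0 : ℝ), Real.exp (-p * t) * t ^ (n - 1) * h t)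
        + n * (n - 1) * (∫ t in Ioi (0 : ℝ), Real.exp (-p * t) * t ^ (n - 2) * h t) := by
  have h0 := (hh n).integrable.const_mul (p ^ 2)
  have h1 := (hh (n - 1)).integrable.const_mul (2 * n * p)
  have h2 := (hh (n - 2)).integrable.const_mul ((n : ℝ) * (n - 1))
  refine ⟨(h0.sub h1).add h2, ?_⟩
  simp only [← integral_const_mul]
  rw [← integral_sub h0 h1]
  exact integral_add (h0.sub h1) h2

/-- The weight is the second derivative of `t ↦ exp (-p t) t ^ n`. -/
lemma ConcaveOn.integral_deriv_deriv_kernel_nonpos {f : ℝ → ℝ} (hf : ConcaveOn ℝ (Ici 0) f)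
    (hnn : ∀ t : ℝ, 0 ≤ t → 0 ≤ f t) {p : ℝ} (hp : 0 < p)
    (hf_int : ∀ n : ℕ, IntegrableOn (fun t => Real.exp (-p * t) * t ^ n * f t) (Ioi 0))
    {n : ℕ} (hn : 1 ≤ n) :
    p ^ 2 * (∫ t in Ioi (0 : ℝ), Real.exp (-p * t) * t ^ n * f t)
      - 2 * n * p * (∫ t in Ioi (0 : ℝ), Real.exp (-p * t) * t ^ (n - 1) * f t)
      + n * (n - 1) * (∫ t in Ioi (0 : ℝ), Real.exp (-p * t) * t ^ (n - 2) * f t) ≤ 0 := by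
  have hn' : (1 : ℝ) ≤ n := by exact_mod_cast hn
  have hs : √(n : ℝ) ^ 2 = n := Real.sq_sqrt (by positivity)
  have hs1 : 1 ≤ √(n : ℝ) := Real.one_le_sqrt.2 hn'
  obtain ⟨A, B, hA, hAB⟩ := hf.exists_chord hnn (a := (n - √n) / p) (b := (n + √n) / p)
    (div_nonneg (by nlinarith) hp.le) (by gcongr; linarith)
  have hchord (k : ℕ) : IntegrableOn (fun t => Real.exp (-p * t) * t ^ k * (A + B * t)) (Ioi 0) := by
    refine (((integrableOn_exp_neg_mul_mul_pow hp k).integrable.const_mul A).add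
      ((integrableOn_exp_neg_mul_mul_pow hp (k + 1)).integrable.const_mul B)).congr
      (ae_of_all _ fun t => ?_)
    simp only [Pi.add_apply]
    ring
  have hchord_eq (k : ℕ) : ∫ t in Ioi (0 : ℝ), Real.exp (-p * t) * t ^ k * (A + B * t) =
      A * (k.factorial / p ^ (k + 1)) + B * ((k + 1).factorial / p ^ (k + 2)) := by
    rw [← integral_exp_neg_mul_mul_pow hp, ← integral_exp_neg_mul_mul_pow hp,
      ← integral_const_mul, ← integral_const_mul, ← integral_add
      ((integrableOn_exp_neg_mul_mul_pow hp k).const_mul A)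
      ((integrableOn_exp_neg_mul_mul_pow hp (k + 1)).const_mul B)]
    congr 1 with t
    ring
  calc _ ≤ p ^ 2 * (∫ t in Ioi (0 : ℝ), Real.exp (-p * t) * t ^ n * (A + B * t))
      - 2 * n * p * (∫ t in Ioi (0 : ℝ), Real.exp (-p * t) * t ^ (n - 1) * (A + B * t))
      + n * (n - 1) * (∫ t in Ioi (0 : ℝ), Real.exp (-p * t) * t ^ (n - 2) * (A + B * t)) := by
        obtain ⟨hi, hi_eq⟩ := integral_deriv_deriv_kernel_mul hf_int n
        obtain ⟨hc, hc_eq⟩ := integral_deriv_deriv_kernel_mul hchord n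
        rw [← hi_eq, ← hc_eq]
        refine setIntegral_mono_on hi hc measurableSet_Ioi
          fun t (ht : 0 < t) => ?_
        have hroots : p ^ 2 * ((t - (n - √n) / p) * (t - (n + √n) / p)) =
            p ^ 2 * t ^ 2 - 2 * n * p * t + n * (n - 1) := by
          field_simp
          linear_combination -hs
        have hweight : t * (p ^ 2 * t ^ n - 2 * n * p * t ^ (n - 1) + n * (n - 1) * t ^ (n - 2)) =
            t ^ (n - 1) * (p ^ 2 * t ^ 2 - 2 * n * p * t + n * (n - 1)) := by
          obtain ⟨m, rfl⟩ := Nat.exists_eq_add_of_le' hn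
          rcases m with _ | m <;> simp <;> ring
        have hneg := mul_nonpos_of_nonneg_of_nonpos
          (show 0 ≤ Real.exp (-p * t) * t ^ (n - 1) * p ^ 2 by positivity) (hAB t ht.le)
        refine le_of_mul_le_mul_left ?_ ht
        linear_combination hneg + Real.exp (-p * t) * (f t - (A + B * t)) * hweight
          - Real.exp (-p * t) * t ^ (n - 1) * (f t - (A + B * t)) * hroots
    _ ≤ 0 := by
        simp only [hchord_eq]
        obtain ⟨m, rfl⟩ := Nat.exists_eq_add_of_le' hn
        rcases m with _ | m
        · simp
          field_simp
          linarith [mul_nonneg hp.le hA]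
        · refine le_of_eq ?_
          simp [Nat.factorial_succ]
          field_simp
          ring

/-- A nonnegative, nondecreasing, concave function grows at most linearly. -/
lemma ConcaveOn.le_mul_one_add {f : ℝ → ℝ} (hf : ConcaveOn ℝ (Ici 0) f)
    (hnn : ∀ t : ℝ, 0 ≤ t → 0 ≤ f t) (hmono : MonotoneOn f (Ici 0)) {t : ℝ} (ht : 0 ≤ t) :
    f t ≤ f 1 * (1 + t) := by
  have h1 := hnn 1 zero_le_one
  rcases le_or_gt t 1 with h | h
  · have := hmono ht (zero_le_one (α := ℝ)) h
    nlinarith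
  · have h3 := hf.neg.secant_mono_aux1 (x := 0) (y := 1) (z := t) self_mem_Ici ht one_pos h
    simp only [Pi.neg_apply] at h3
    nlinarith [hnn 0 le_rfl]

/-- if `f : [0,∞) → ℝ` is nonnegative, nondecreasing and concave (a CrF),
then for every `p > 0` the Laplace transform integral `∫₀^∞ e^{-pt} f(t) dt` converges,
and `g(p) = p² ∫₀^∞ e^{-pt} f(t) dt` is a Bernstein function on `(0,∞)`: nonnegative,
infinitely differentiable, with `(-1)^{n-1} g⁽ⁿ⁾(p) ≥ 0` for all `p > 0`, `n ≥ 1`. -/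
theorem crf_laplace_is_bernstein (f : ℝ → ℝ)
    (hnn : ∀ t : ℝ, 0 ≤ t → 0 ≤ f t)
    (hmono : MonotoneOn f (Set.Ici 0))
    (hconc : ConcaveOn ℝ (Set.Ici 0) f) :
    (∀ p : ℝ, 0 < p → IntegrableOn (fun t => Real.exp (-p * t) * f t) (Set.Ioi 0)) ∧
    ∀ g : ℝ → ℝ,
      (∀ p : ℝ, g p = p ^ 2 * ∫ t in Set.Ioi (0 : ℝ), Real.exp (-p * t) * f t) →
      (∀ p : ℝ, 0 < p → 0 ≤ g p) ∧
      ContDiffOn ℝ (⊤ : ℕ∞) g (Set.Ioi 0) ∧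
      ∀ n : ℕ, 1 ≤ n → ∀ p : ℝ, 0 < p →
        0 ≤ (-1 : ℝ) ^ (n - 1) * iteratedDerivWithin n g (Set.Ioi 0) p := by
  have hmeas : AEMeasurable f (volume.restrict (Ioi 0)) :=
    aemeasurable_restrict_of_monotoneOn measurableSet_Ioi (hmono.mono Ioi_subset_Ici_self)
  have hf_int (p : ℝ) (hp : 0 < p) :
      IntegrableOn (fun t => Real.exp (-p * t) * f t) (Ioi 0) := by
    have hdom := ((integrableOn_exp_neg_mul_mul_pow hp 0).add
      (integrableOn_exp_neg_mul_mul_pow hp 1)).const_mul (f 1)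
    refine Integrable.mono' hdom ?_ ?_
    · exact (by fun_prop : Continuous fun t : ℝ => Real.exp (-p * t)).aestronglyMeasurable.mul
        hmeas.aestronglyMeasurable
    · filter_upwards [ae_restrict_mem measurableSet_Ioi] with t ht
      have ht' : 0 ≤ t := le_of_lt ht
      rw [Real.norm_of_nonneg (mul_nonneg (Real.exp_pos _).le (hnn t ht'))]
      have := mul_le_mul_of_nonneg_left (hconc.le_mul_one_add hnn hmono ht')
        (Real.exp_pos (-p * t)).le
      simp only [Pi.add_apply]
      linear_combination this
  refine ⟨hf_int, fun g hg => ?_⟩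
  have hmoment {p : ℝ} (hp : 0 < p) := laplace_moment_integrableOn_and_hasDerivAt hmeas
    (fun t ht => hnn t ht.le) hf_int hp
  have hiter (n : ℕ) {p : ℝ} (hp : 0 < p) := iteratedDerivWithin_sq_mul
    (F := fun k q => ∫ t in Ioi (0 : ℝ), Real.exp (-q * t) * t ^ k * f t)
    (fun k q hq => (hmoment hq k).2) n hp
  have hg' : (fun q => q ^ 2 * ∫ t in Ioi (0 : ℝ), Real.exp (-q * t) * t ^ 0 * f t) = g := by
    funext q
    simp [hg]
  simp only [hg'] at hiter
  refine ⟨fun p _ => ?_, ?_, fun n hn p hp => ?_⟩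
  · rw [hg]
    exact mul_nonneg (sq_nonneg p) (setIntegral_nonneg measurableSet_Ioi
      fun t ht => mul_nonneg (Real.exp_pos _).le (hnn t (le_of_lt ht)))
  · refine contDiffOn_of_differentiableOn_deriv fun n _ => ?_
    refine DifferentiableOn.congr (fun p hp => ?_) fun p hp => hiter n hp
    have hd (k : ℕ) := (hmoment hp k).2.differentiableAt
    have h0 := hd n
    have h1 := hd (n - 1)
    have h2 := hd (n - 2)
    exact DifferentiableAt.differentiableWithinAt (by fun_prop)
  · rw [hiter n hp]
    have h := hconc.integral_deriv_deriv_kernel_nonpos hnn hp (fun k => (hmoment hp k).1) hn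
    obtain ⟨m, rfl⟩ := Nat.exists_eq_add_of_le' hn
    have hsq : ((-1 : ℝ)) ^ m * (-1) ^ m = 1 := by
      rw [← mul_pow]; simp
    rw [Nat.add_sub_cancel, ← mul_assoc, pow_succ, ← mul_assoc, hsq]
    rw [Nat.add_sub_cancel] at h
    linarith
end

section
/- Let f : [0,∞) → ℝ be a Bernstein function, i.e. f is nonnegative, continuous on [0,∞), infinitely differentiable on (0,∞), and (−1)^{n−1} f⁽ⁿ⁾(x) ≥ 0 for all x > 0 and all integers n ≥ 1. Then there exists a function g : [0,∞) → ℝ that is nonnegative, nondecreasing and concave, such that f(p) = p² ∫₀^∞ e^{−pt} g(t) dt for all p > 0. -/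
open MeasureTheory Set Filter

/-- A Bernstein function: nonnegative, continuous on `[0,∞)`, smooth on `(0,∞)`,
with `(-1)^{n-1} f⁽ⁿ⁾(x) ≥ 0` for all `x > 0` and all integers `n ≥ 1`. -/
def IsBernstein (f : ℝ → ℝ) : Prop :=
  (∀ x : ℝ, 0 ≤ x → 0 ≤ f x) ∧ ContinuousOn f (Set.Ici 0) ∧
  ContDiffOn ℝ (⊤ : ℕ∞) f (Set.Ioi 0) ∧
  ∀ n : ℕ, 1 ≤ n → ∀ x : ℝ, 0 < x →
    0 ≤ (-1 : ℝ) ^ (n - 1) * iteratedDerivWithin n f (Set.Ioi 0) x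

/-- A creep function: nonnegative, nondecreasing and concave on `[0,∞)`. -/
structure IsCreep (g : ℝ → ℝ) : Prop where
  nonneg : ∀ t : ℝ, 0 ≤ t → 0 ≤ g t
  mono : MonotoneOn g (Ici 0)
  concave : ConcaveOn ℝ (Ici 0) g

/-- `F` is, on `(0,∞)`, `p²` times the Laplace transform of the function `g`. -/
def IsLaplaceOf (F g : ℝ → ℝ) : Prop :=
  ∀ p : ℝ, 0 < p → F p = p ^ 2 * ∫ t in Ioi (0 : ℝ), Real.exp (-p * t) * g t

namespace IsCreep

lemma le_div_mul {g : ℝ → ℝ} (hg : IsCreep g) {s t : ℝ} (hs : 0 < s) (hst : s ≤ t) :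
    g t ≤ t / s * g s := by
  have ht : 0 < t := hs.trans_le hst
  have hs1 : s / t ≤ 1 := (div_le_one ht).2 hst
  have h := hg.concave.2 (mem_Ici.2 ht.le) (mem_Ici.2 le_rfl)
    (show 0 ≤ s / t by positivity) (sub_nonneg.2 hs1) (by ring)
  simp only [smul_eq_mul, mul_zero, add_zero] at h
  rw [div_mul_cancel₀ _ ht.ne'] at h
  have h0 : 0 ≤ (1 - s / t) * g 0 := mul_nonneg (by linarith) (hg.nonneg 0 le_rfl)
  have h1 : s / t * g t ≤ g s := by linarith
  calc g t = t / s * (s / t * g t) := by field_simp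
    _ ≤ t / s * g s := by gcongr

lemma le_linear {g : ℝ → ℝ} (hg : IsCreep g) {t : ℝ} (ht : 0 ≤ t) : g t ≤ g 1 * (1 + t) := by
  have h1 := hg.nonneg 1 zero_le_one
  rcases le_total t 1 with h | h
  · have := hg.mono (a := t) (b := 1) ht (zero_le_one (α := ℝ)) h
    nlinarith
  · have := hg.le_div_mul one_pos h
    rw [div_one] at this
    nlinarith

lemma add {g h : ℝ → ℝ} (hg : IsCreep g) (hh : IsCreep h) : IsCreep (g + h) :=
  ⟨fun t ht => add_nonneg (hg.nonneg t ht) (hh.nonneg t ht), hg.mono.add hh.mono,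
    hg.concave.add hh.concave⟩

lemma const_mul {g : ℝ → ℝ} (hg : IsCreep g) {c : ℝ} (hc : 0 ≤ c) :
    IsCreep (fun t => c * g t) :=
  ⟨fun t ht => mul_nonneg hc (hg.nonneg t ht),
    fun _ ha _ hb hab => mul_le_mul_of_nonneg_left (hg.mono ha hb hab) hc,
    hg.concave.smul hc⟩

lemma id : IsCreep (fun t => t) :=
  ⟨fun _ h => h, fun _ _ _ _ h => h, concaveOn_id (convex_Ici 0)⟩

lemma min_const {s : ℝ} (hs : 0 ≤ s) : IsCreep (fun t => min t s) :=
  ⟨fun _ h => le_min h hs, fun _ _ _ _ h => min_le_min_right s h,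
    (concaveOn_id (convex_Ici 0)).inf (concaveOn_const s (convex_Ici 0))⟩

end IsCreep

lemma laplace_sub_aux {p : ℝ} (hp : 0 < p) (s : ℝ) :
    IntegrableOn (fun t => Real.exp (-p * t) * (t - s)) (Ioi s) ∧
    ∫ t in Ioi s, Real.exp (-p * t) * (t - s) = Real.exp (-p * s) / p ^ 2 := by
  have hd : ∀ x ∈ Ici s, HasDerivAt
      (fun t => -(Real.exp (-p * t) * ((t - s) / p + 1 / p ^ 2)))
      (Real.exp (-p * x) * (x - s)) x := by
    intro x _
    have h1 : HasDerivAt (fun t : ℝ => Real.exp (-p * t)) (Real.exp (-p * x) * (-p)) x := by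
      simpa using ((hasDerivAt_id x).const_mul (-p)).exp
    have h2 : HasDerivAt (fun t : ℝ => (t - s) / p + 1 / p ^ 2) (1 / p) x :=
      (((hasDerivAt_id x).sub_const s).div_const p).add_const _
    refine (h1.mul h2).neg.congr_deriv ?_
    field_simp
    ring
  have hn : ∀ x ∈ Ioi s, 0 ≤ Real.exp (-p * x) * (x - s) := fun x hx =>
    mul_nonneg (Real.exp_pos _).le (sub_nonneg.2 (le_of_lt hx))
  have hl : Tendsto (fun t => -(Real.exp (-p * t) * ((t - s) / p + 1 / p ^ 2))) atTop
      (nhds 0) := by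
    have hpt : Tendsto (fun t : ℝ => p * t) atTop atTop := tendsto_id.const_mul_atTop hp
    have h0 := (Real.tendsto_pow_mul_exp_neg_atTop_nhds_zero 0).comp hpt
    have h1 := (Real.tendsto_pow_mul_exp_neg_atTop_nhds_zero 1).comp hpt
    have := (h1.mul_const (-(1 / p ^ 2))).add (h0.mul_const (s / p - 1 / p ^ 2))
    simp only [zero_mul, add_zero] at this
    refine this.congr fun t => ?_
    simp only [Function.comp, pow_one, pow_zero, neg_mul]
    field_simp
    ring
  refine ⟨integrableOn_Ioi_deriv_of_nonneg' hd hn hl, ?_⟩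
  rw [integral_Ioi_of_hasDerivAt_of_nonneg' hd hn hl]
  simp
  ring

lemma integrableOn_exp_mul_linear {p : ℝ} (hp : 0 < p) (M : ℝ) :
    IntegrableOn (fun t => Real.exp (-p * t) * (M * (1 + t))) (Ioi 0) := by
  have h1 := (laplace_sub_aux hp 0).1
  have h2 := integrableOn_exp_mul_Ioi (neg_lt_zero.2 hp) 0
  refine ((h1.add h2).const_mul M).congr (Eventually.of_forall fun t => ?_)
  simp only [Pi.add_apply]
  ring

lemma IsCreep.aestronglyMeasurable {g : ℝ → ℝ} (hg : IsCreep g) (p : ℝ) :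
    AEStronglyMeasurable (fun t => Real.exp (-p * t) * g t) (volume.restrict (Ioi 0)) := by
  have h : AEMeasurable g (volume.restrict (Ioi 0)) :=
    aemeasurable_restrict_of_monotoneOn measurableSet_Ioi (hg.mono.mono Ioi_subset_Ici_self)
  exact ((by fun_prop : Measurable fun t : ℝ => Real.exp (-p * t)).aemeasurable.mul
    h).aestronglyMeasurable

lemma IsCreep.norm_le {g : ℝ → ℝ} (hg : IsCreep g) (p : ℝ) {t M : ℝ} (ht : 0 ≤ t)
    (hM : g 1 ≤ M) : ‖Real.exp (-p * t) * g t‖ ≤ Real.exp (-p * t) * (M * (1 + t)) := by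
  rw [Real.norm_of_nonneg (mul_nonneg (Real.exp_pos _).le (hg.nonneg t ht))]
  have := hg.le_linear ht
  gcongr
  exact this.trans (by gcongr)

lemma IsCreep.integrableOn {g : ℝ → ℝ} (hg : IsCreep g) {p : ℝ} (hp : 0 < p) :
    IntegrableOn (fun t => Real.exp (-p * t) * g t) (Ioi 0) :=
  (integrableOn_exp_mul_linear hp (g 1)).mono' (hg.aestronglyMeasurable p) <|
    (ae_restrict_iff' measurableSet_Ioi).2 <| Eventually.of_forall fun _ ht =>
      hg.norm_le p (le_of_lt ht) le_rfl

lemma IsLaplaceOf.add {F G g h : ℝ → ℝ} (hF : IsLaplaceOf F g) (hG : IsLaplaceOf G h)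
    (hg : IsCreep g) (hh : IsCreep h) : IsLaplaceOf (F + G) (g + h) := by
  intro p hp
  simp only [Pi.add_apply, mul_add]
  rw [integral_add (hg.integrableOn hp) (hh.integrableOn hp), hF p hp, hG p hp, mul_add]

lemma IsLaplaceOf.const_mul {F g : ℝ → ℝ} (hF : IsLaplaceOf F g) (c : ℝ) :
    IsLaplaceOf (fun p => c * F p) (fun t => c * g t) := by
  intro p hp
  dsimp only
  rw [hF p hp, show (fun t => Real.exp (-p * t) * (c * g t)) =
    fun t => c * (Real.exp (-p * t) * g t) by ext; ring, integral_const_mul]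
  ring

lemma isLaplaceOf_one_id : IsLaplaceOf (fun _ => 1) (fun t => t) := by
  intro p hp
  have := (laplace_sub_aux hp 0).2
  simp only [sub_zero, mul_zero, Real.exp_zero] at this
  rw [this]
  field_simp

lemma isLaplaceOf_min_const {s : ℝ} (hs : 0 ≤ s) :
    IsLaplaceOf (fun p => 1 - Real.exp (-p * s)) (fun t => min t s) := by
  intro p hp
  obtain ⟨i0, e0⟩ := laplace_sub_aux hp 0
  obtain ⟨i1, e1⟩ := laplace_sub_aux hp s
  simp only [sub_zero, mul_zero, Real.exp_zero] at i0 e0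
  have hI : Ioi (0 : ℝ) ∩ Ioi s = Ioi s := inter_eq_right.2 (Ioi_subset_Ioi hs)
  have hind : (fun t => Real.exp (-p * t) * min t s) = fun t => Real.exp (-p * t) * t -
      (Ioi s).indicator (fun t => Real.exp (-p * t) * (t - s)) t := by
    ext t
    by_cases h : s < t
    · rw [indicator_of_mem (by exact h), min_eq_right h.le]; ring
    · rw [indicator_of_notMem (by exact h), min_eq_left (not_lt.1 h)]; ring
  rw [hind, integral_sub i0 ((i1.integrable_indicator measurableSet_Ioi).integrableOn),
    setIntegral_indicator measurableSet_Ioi, hI, e0, e1]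
  field_simp

lemma IsCreep.apply_one_le {F g : ℝ → ℝ} (hg : IsCreep g) (hF : IsLaplaceOf F g) :
    g 1 ≤ Real.exp 1 * F 1 := by
  have h1 : ∫ t in Ioi (1 : ℝ), Real.exp (-1 * t) * g 1 ≤ F 1 := by
    rw [hF 1 one_pos, one_pow, one_mul]
    have hsub : Ioi (1 : ℝ) ⊆ Ioi 0 := Ioi_subset_Ioi zero_le_one
    refine le_trans ?_ (setIntegral_mono_set (hg.integrableOn one_pos) ?_ hsub.eventuallyLE)
    · refine setIntegral_mono_on ((integrableOn_exp_mul_Ioi (by norm_num) 1).mul_const _)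
        ((hg.integrableOn one_pos).mono_set hsub) measurableSet_Ioi fun t ht => ?_
      have ht : (1 : ℝ) < t := ht
      gcongr
      exact hg.mono (zero_le_one (α := ℝ)) (zero_le_one.trans ht.le : (0 : ℝ) ≤ t) ht.le
    · exact (ae_restrict_iff' measurableSet_Ioi).2 <| Eventually.of_forall fun t ht =>
        mul_nonneg (Real.exp_pos _).le (hg.nonneg t (le_of_lt ht))
  rw [integral_mul_const, integral_exp_mul_Ioi (by norm_num)] at h1
  have : g 1 = Real.exp 1 * (-Real.exp (-1 * 1) / -1 * g 1) := by
    rw [neg_div_neg_eq, div_one, ← mul_assoc, ← Real.exp_add]; simp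
  rw [this]
  gcongr

/-- A Helly-type selection principle for creep functions. -/
lemma exists_subseq_tendsto_isCreep {g : ℕ → ℝ → ℝ} (hg : ∀ n, IsCreep (g n)) {M : ℝ}
    (hM : ∀ n, g n 1 ≤ M) :
    ∃ G : ℝ → ℝ, ∃ φ : ℕ → ℕ, StrictMono φ ∧ IsCreep G ∧
      ∀ t, 0 ≤ t → Tendsto (fun n => g (φ n) t) atTop (nhds (G t)) := by
  have hM0 : 0 ≤ M := ((hg 0).nonneg 1 zero_le_one).trans (hM 0)
  have hle : ∀ n t, 0 ≤ t → g n t ≤ M * (1 + t) := fun n t ht =>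
    ((hg n).le_linear ht).trans (by gcongr; exact hM n)
  obtain ⟨L, -, φ, hφ, hL⟩ := (isCompact_univ_pi fun q : ℚ =>
    isCompact_Icc (a := (0 : ℝ)) (b := M * (1 + |(q : ℝ)|))).tendsto_subseq
    (x := fun n (q : ℚ) => g n |(q : ℝ)|)
    fun n q _ => ⟨(hg n).nonneg _ (abs_nonneg _), hle n _ (abs_nonneg _)⟩
  rw [tendsto_pi_nhds] at hL
  have hconv : ∀ t, 0 ≤ t → ∃ l, Tendsto (fun n => g (φ n) t) atTop (nhds l) := by
    intro t ht
    rcases ht.eq_or_lt with rfl | ht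
    · exact ⟨L 0, by simpa [Function.comp_def] using hL 0⟩
    refine cauchySeq_tendsto_of_complete (Metric.cauchySeq_iff'.2 fun ε hε => ?_)
    have hlim : Tendsto (fun q : ℝ => (t / q - 1) * (M * (1 + t))) (nhdsWithin t (Iio t))
        (nhds 0) := by
      have : ContinuousAt (fun q : ℝ => (t / q - 1) * (M * (1 + t))) t := by
        have := ht.ne'
        fun_prop (disch := assumption)
      have := this.tendsto
      simp only [div_self ht.ne', sub_self, zero_mul] at this
      exact this.mono_left nhdsWithin_le_nhds
    have hev := (hlim.eventually (gt_mem_nhds (show (0 : ℝ) < ε / 3 by positivity))).and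
      (Ioo_mem_nhdsLT ht)
    obtain ⟨b, hb, hbt⟩ := (mem_nhdsLT_iff_exists_Ioo_subset' ht).1 hev
    obtain ⟨q, hq1, hq2⟩ := exists_rat_btwn (mem_Iio.1 hb)
    obtain ⟨hqε, hq0, -⟩ := hbt ⟨hq1, hq2⟩
    have happrox : ∀ n, g n q ≤ g n t ∧ g n t - g n q < ε / 3 := by
      intro n
      refine ⟨(hg n).mono hq0.le ht.le hq2.le, lt_of_le_of_lt ?_ hqε⟩
      have h1 := (hg n).le_div_mul hq0 hq2.le
      have h2 : g n q ≤ M * (1 + t) := (hle n q hq0.le).trans (by gcongr)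
      have h3 : 0 ≤ t / q - 1 := by
        rw [sub_nonneg, one_le_div hq0]; exact hq2.le
      nlinarith
    have hcq : CauchySeq fun n => g (φ n) q := by
      have := (hL q).cauchySeq
      simpa [Function.comp_def, abs_of_pos hq0] using this
    obtain ⟨N, hN⟩ := Metric.cauchySeq_iff'.1 hcq (ε / 3) (by positivity)
    refine ⟨N, fun n hn => ?_⟩
    have h := hN n hn
    rw [Real.dist_eq, abs_lt] at h ⊢
    have h1 := happrox (φ n)
    have h2 := happrox (φ N)
    constructor <;> linarith
  choose! G hG using hconv
  refine ⟨G, φ, hφ, ⟨fun t ht => ge_of_tendsto' (hG t ht) fun n => (hg _).nonneg t ht,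
    fun a ha b hb hab => le_of_tendsto_of_tendsto' (hG a ha) (hG b hb) fun n =>
      (hg _).mono ha hb hab, convex_Ici 0, fun x hx y hy a b ha hb hab => ?_⟩, hG⟩
  exact le_of_tendsto_of_tendsto' (((hG x hx).const_mul a).add ((hG y hy).const_mul b))
    (hG _ ((convex_Ici (0 : ℝ)) hx hy ha hb hab)) fun n => (hg _).concave.2 hx hy ha hb hab

/-- The functions `p² ∫₀^∞ e^{-pt} g(t) dt` with `g` a creep function are closed under pointwise
limits on `(0,∞)`. -/
lemma exists_isCreep_of_tendsto {F : ℕ → ℝ → ℝ} {f : ℝ → ℝ}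
    (hF : ∀ n, ∃ g, IsCreep g ∧ IsLaplaceOf (F n) g)
    (hf : ∀ p, 0 < p → Tendsto (fun n => F n p) atTop (nhds (f p))) :
    ∃ g, IsCreep g ∧ IsLaplaceOf f g := by
  choose g hg hgF using hF
  obtain ⟨C, hC⟩ := (hf 1 one_pos).bddAbove_range
  have hM : ∀ n, g n 1 ≤ Real.exp 1 * C := fun n =>
    ((hg n).apply_one_le (hgF n)).trans (by gcongr; exact hC ⟨n, rfl⟩)
  obtain ⟨G, φ, hφ, hG, hlim⟩ := exists_subseq_tendsto_isCreep hg hM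
  refine ⟨G, hG, fun p hp => ?_⟩
  have h := tendsto_integral_of_dominated_convergence
    (μ := volume.restrict (Ioi (0 : ℝ)))
    (F := fun n t => Real.exp (-p * t) * g (φ n) t) (f := fun t => Real.exp (-p * t) * G t)
    (fun t => Real.exp (-p * t) * (Real.exp 1 * C * (1 + t)))
    (fun n => (hg _).aestronglyMeasurable p) (integrableOn_exp_mul_linear hp _)
    (fun n => (ae_restrict_iff' measurableSet_Ioi).2 <| Eventually.of_forall fun t ht =>
      (hg _).norm_le p (le_of_lt ht) (hM _))
    ((ae_restrict_iff' measurableSet_Ioi).2 <| Eventually.of_forall fun t ht =>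
      (hlim t (le_of_lt ht)).const_mul _)
  refine tendsto_nhds_unique ((hf p hp).comp hφ.tendsto_atTop) ?_
  refine (h.const_mul (p ^ 2)).congr fun n => ?_
  exact (hgF (φ n) p hp).symm

namespace IsBernstein

variable {f : ℝ → ℝ}

lemma contDiffAt (hf : IsBernstein f) {x : ℝ} (hx : 0 < x) (n : ℕ) : ContDiffAt ℝ n f x :=
  (hf.2.2.1.contDiffAt (Ioi_mem_nhds hx)).of_le (mod_cast le_top)

lemma iteratedDeriv_nonneg (hf : IsBernstein f) (k : ℕ) {x : ℝ} (hx : 0 < x) :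
    0 ≤ (-1 : ℝ) ^ k * iteratedDeriv (k + 1) f x := by
  have h := hf.2.2.2 (k + 1) (Nat.le_add_left 1 k) x hx
  rwa [iteratedDerivWithin_of_isOpen isOpen_Ioi hx, Nat.add_sub_cancel] at h

/-- The coefficient of `(x₀ - y)^(k+1)` in the Taylor expansion of `f(x₀) - f(y)` at `x₀`. -/
noncomputable def taylorCoeff (f : ℝ → ℝ) (k : ℕ) (x : ℝ) : ℝ :=
  (-1 : ℝ) ^ k * iteratedDeriv (k + 1) f x / (k + 1).factorial

lemma taylorCoeff_nonneg (hf : IsBernstein f) (k : ℕ) {x : ℝ} (hx : 0 < x) :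
    0 ≤ taylorCoeff f k x :=
  div_nonneg (hf.iteratedDeriv_nonneg k hx) (Nat.cast_nonneg _)

lemma iteratedDerivWithin_uIcc (hf : IsBernstein f) {x₀ y x : ℝ} (hy : 0 < y) (hyx : y < x₀)
    (hx : x ∈ uIcc x₀ y) (n : ℕ) :
    iteratedDerivWithin n f (uIcc x₀ y) x = iteratedDeriv n f x := by
  refine iteratedDerivWithin_eq_iteratedDeriv (uniqueDiffOn_uIcc hyx.ne') ?_ hx
  rw [uIcc_of_ge hyx.le] at hx
  exact hf.contDiffAt (hy.trans_le hx.1) n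

lemma contDiffOn_uIcc (hf : IsBernstein f) {x₀ y : ℝ} (hy : 0 < y) (hyx : y < x₀) (n : ℕ) :
    ContDiffOn ℝ n f (uIcc x₀ y) := fun x hx => by
  rw [uIcc_of_ge hyx.le] at hx
  exact (hf.contDiffAt (hy.trans_le hx.1) n).contDiffWithinAt

lemma differentiableOn_iteratedDerivWithin (hf : IsBernstein f) {x₀ y : ℝ} (hy : 0 < y)
    (hyx : y < x₀) (n : ℕ) :
    DifferentiableOn ℝ (iteratedDerivWithin n f (uIcc x₀ y)) (uIoo x₀ y) :=
  ((hf.contDiffOn_uIcc hy hyx (n + 1)).differentiableOn_iteratedDerivWithin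
    (mod_cast n.lt_succ_self) (uniqueDiffOn_uIcc hyx.ne')).mono Ioo_subset_Icc_self

lemma taylorWithinEval_eq (hf : IsBernstein f) {x₀ y : ℝ} (hy : 0 < y) (hyx : y < x₀) (n : ℕ) :
    taylorWithinEval f n (uIcc x₀ y) x₀ y =
      f x₀ - ∑ k ∈ Finset.range n, taylorCoeff f k x₀ * (x₀ - y) ^ (k + 1) := by
  rw [taylor_within_apply, Finset.sum_range_succ', sub_eq_add_neg (f x₀), add_comm,
    ← Finset.sum_neg_distrib]
  congr 1
  · simp
  · refine Finset.sum_congr rfl fun k _ => ?_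
    rw [hf.iteratedDerivWithin_uIcc hy hyx left_mem_uIcc, ← neg_sub x₀ y, neg_pow, taylorCoeff,
      smul_eq_mul]
    ring

lemma sum_taylorCoeff_le (hf : IsBernstein f) {x₀ y : ℝ} (hy : 0 < y) (hyx : y < x₀) (n : ℕ) :
    ∑ k ∈ Finset.range n, taylorCoeff f k x₀ * (x₀ - y) ^ (k + 1) ≤ f x₀ - f y := by
  obtain ⟨ξ, hξ, h⟩ := taylor_mean_remainder_lagrange (n := n) hyx.ne'
    (hf.contDiffOn_uIcc hy hyx n) (hf.differentiableOn_iteratedDerivWithin hy hyx n)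
  rw [hf.taylorWithinEval_eq hy hyx,
    hf.iteratedDerivWithin_uIcc hy hyx (Ioo_subset_Icc_self hξ)] at h
  rw [uIoo_of_ge hyx.le] at hξ
  have hc := hf.taylorCoeff_nonneg n (hy.trans hξ.1)
  have h2 : iteratedDeriv (n + 1) f ξ * (y - x₀) ^ (n + 1) / (n + 1).factorial =
      -(taylorCoeff f n ξ * (x₀ - y) ^ (n + 1)) := by
    rw [← neg_sub x₀ y, neg_pow, taylorCoeff]
    ring
  rw [h2] at h
  have := mul_nonneg hc (pow_nonneg (sub_nonneg.2 hyx.le) (n + 1))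
  linarith

lemma monotoneOn (hf : IsBernstein f) : MonotoneOn f (Ioi 0) := by
  intro a ha b _ hab
  rcases hab.eq_or_lt with rfl | hab
  · exact le_rfl
  · simpa using hf.sum_taylorCoeff_le ha hab 0

lemma tendsto_sum_taylorCoeff (hf : IsBernstein f) {x₀ y : ℝ} (hy : 0 < y) (hyx : y < x₀) :
    Tendsto (fun n => ∑ k ∈ Finset.range n, taylorCoeff f k x₀ * (x₀ - y) ^ (k + 1)) atTop
      (nhds (f x₀ - f y)) := by
  obtain ⟨z, hz, hzy⟩ := exists_between hy
  set r := (x₀ - y) / (x₀ - z) with hr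
  have hr0 : 0 ≤ r := div_nonneg (by linarith) (by linarith)
  have hr1 : r < 1 := (div_lt_one (by linarith)).2 (by linarith)
  set C := f x₀ * ((x₀ - y) / (y - z)) with hC
  have hlim : Tendsto (fun n : ℕ => f x₀ - f y - C * (n * r ^ n + r ^ n)) atTop
      (nhds (f x₀ - f y)) := by
    have := ((tendsto_self_mul_const_pow_of_lt_one hr0 hr1).add
      (tendsto_pow_atTop_nhds_zero_of_lt_one hr0 hr1)).const_mul C
    simpa using this.const_sub (f x₀ - f y)
  refine tendsto_of_tendsto_of_tendsto_of_le_of_le hlim tendsto_const_nhds (fun n => ?_)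
    (fun n => hf.sum_taylorCoeff_le hy hyx n)
  obtain ⟨ξ, hξ, h⟩ := taylor_mean_remainder_cauchy (n := n) hyx.ne'
    (hf.contDiffOn_uIcc hy hyx n) (hf.differentiableOn_iteratedDerivWithin hy hyx n)
  rw [hf.taylorWithinEval_eq hy hyx,
    hf.iteratedDerivWithin_uIcc hy hyx (Ioo_subset_Icc_self hξ)] at h
  rw [uIoo_of_ge hyx.le] at hξ
  obtain ⟨hyξ, hξx⟩ := hξ
  have hξ0 : 0 < ξ := hy.trans hyξ
  have hzξ : z < ξ := hzy.trans hyξ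
  have h2 : iteratedDeriv (n + 1) f ξ * (y - ξ) ^ n / n.factorial * (y - x₀) =
      -(taylorCoeff f n ξ * ((n + 1) * (ξ - y) ^ n * (x₀ - y))) := by
    rw [← neg_sub ξ y, neg_pow, taylorCoeff, Nat.factorial_succ]
    push_cast
    field_simp
    ring
  have hterm : taylorCoeff f n ξ * (ξ - z) ^ (n + 1) ≤ f x₀ := by
    have h3 := hf.sum_taylorCoeff_le hz hzξ (n + 1)
    have h4 := Finset.single_le_sum (f := fun k => taylorCoeff f k ξ * (ξ - z) ^ (k + 1))
      (fun k _ => mul_nonneg (hf.taylorCoeff_nonneg k hξ0)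
        (pow_nonneg (sub_nonneg.2 hzξ.le) _)) (Finset.self_mem_range_succ n)
    have h5 := hf.monotoneOn hξ0 (hy.trans hyx) hξx.le
    have h6 := hf.1 z hz.le
    linarith
  have hratio : (ξ - y) / (ξ - z) ≤ r := by
    rw [hr, div_le_div_iff₀ (by linarith) (by linarith)]
    nlinarith
  have hfx : 0 ≤ f x₀ := hf.1 x₀ (hy.trans hyx).le
  have hrem : taylorCoeff f n ξ * ((n + 1) * (ξ - y) ^ n * (x₀ - y)) ≤
      C * (n * r ^ n + r ^ n) := by
    have hzξ' : 0 < ξ - z := sub_pos.2 hzξ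
    have hxy : 0 ≤ x₀ - y := by linarith
    calc taylorCoeff f n ξ * ((n + 1) * (ξ - y) ^ n * (x₀ - y))
        = taylorCoeff f n ξ * (ξ - z) ^ (n + 1) *
          ((n + 1) * ((ξ - y) / (ξ - z)) ^ n * ((x₀ - y) / (ξ - z))) := by
          rw [div_pow, pow_succ]; field_simp
      _ ≤ f x₀ * ((n + 1) * r ^ n * ((x₀ - y) / (y - z))) := by
          have : 0 ≤ (ξ - y) / (ξ - z) := div_nonneg (by linarith) hzξ'.le
          have : 0 < y - z := by linarith
          gcongr
      _ = C * (n * r ^ n + r ^ n) := by rw [hC]; ring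
  linarith

lemma sum_taylorCoeff_mul_pow_le (hf : IsBernstein f) {x₀ : ℝ} (hx : 0 < x₀) (n : ℕ) :
    ∑ k ∈ Finset.range n, taylorCoeff f k x₀ * x₀ ^ (k + 1) ≤ f x₀ := by
  have hc : Continuous fun y : ℝ =>
      ∑ k ∈ Finset.range n, taylorCoeff f k x₀ * (x₀ - y) ^ (k + 1) := by fun_prop
  have h := (hc.tendsto 0).mono_left (nhdsWithin_le_nhds (s := Ioi 0))
  simp only [sub_zero] at h
  refine le_of_tendsto h ?_
  filter_upwards [Ioo_mem_nhdsGT hx] with y hy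
  exact (hf.sum_taylorCoeff_le hy.1 hy.2 n).trans (sub_le_self _ (hf.1 y hy.1.le))

end IsBernstein

/-- Finite combinations `b + ∑ cₖ (1 - e^{-p sₖ})` are represented by creep functions. -/
lemma exists_isCreep_const_add_sum {b : ℝ} (hb : 0 ≤ b) {c s : ℕ → ℝ} (hc : ∀ k, 0 ≤ c k)
    (hs : ∀ k, 0 ≤ s k) (n : ℕ) :
    ∃ g, IsCreep g ∧
      IsLaplaceOf (fun p => b + ∑ k ∈ Finset.range n, c k * (1 - Real.exp (-p * s k))) g := by
  induction n with
  | zero => exact ⟨_, IsCreep.id.const_mul hb, by simpa using isLaplaceOf_one_id.const_mul b⟩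
  | succ n ih =>
    obtain ⟨g, hg, hF⟩ := ih
    have hm := (IsCreep.min_const (hs n)).const_mul (hc n)
    refine ⟨_, hg.add hm, ?_⟩
    convert hF.add ((isLaplaceOf_min_const (hs n)).const_mul (c n)) hg hm using 1
    ext p
    simp only [Finset.sum_range_succ, Pi.add_apply, add_assoc]

/-- Feller's approximations `p ↦ f(x(1 - e^{-p/x}))` of a Bernstein function are represented by
creep functions. -/
lemma IsBernstein.exists_isCreep_comp {f : ℝ → ℝ} (hf : IsBernstein f) {x : ℝ} (hx : 0 < x) :
    ∃ g, IsCreep g ∧ IsLaplaceOf (fun p => f (x - x * Real.exp (-p / x))) g := by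
  refine exists_isCreep_of_tendsto (F := fun n p =>
    f x - ∑ k ∈ Finset.range n, taylorCoeff f k x * x ^ (k + 1) +
      ∑ k ∈ Finset.range n, taylorCoeff f k x * x ^ (k + 1) *
        (1 - Real.exp (-p * ((k + 1 : ℕ) / x)))) (fun n => ?_) (fun p hp => ?_)
  · exact exists_isCreep_const_add_sum (sub_nonneg.2 (hf.sum_taylorCoeff_mul_pow_le hx n))
      (fun k => mul_nonneg (hf.taylorCoeff_nonneg k hx) (by positivity))
      (fun k => by positivity) n
  · have he : Real.exp (-p / x) < 1 :=
      Real.exp_lt_one_iff.2 (div_neg_of_neg_of_pos (by linarith) hx)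
    have hy : 0 < x - x * Real.exp (-p / x) := by nlinarith
    have hyx : x - x * Real.exp (-p / x) < x := sub_lt_self _ (by positivity)
    have h := (hf.tendsto_sum_taylorCoeff hy hyx).const_sub (f x)
    rw [sub_sub_cancel (f x)] at h
    refine h.congr fun n => ?_
    rw [sub_add, ← Finset.sum_sub_distrib]
    congr 1
    refine Finset.sum_congr rfl fun k _ => ?_
    rw [sub_sub_cancel, mul_pow, ← Real.exp_nat_mul,
      show -p * ((k + 1 : ℕ) / x) = (k + 1 : ℕ) * (-p / x) by ring]
    ring

lemma tendsto_sub_mul_exp (p : ℝ) :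
    Tendsto (fun n : ℕ => ((n : ℝ) + 1) - (n + 1) * Real.exp (-p / (n + 1))) atTop (nhds p) := by
  have hd : HasDerivAt (fun u : ℝ => -Real.exp (-p * u)) p 0 := by
    refine (((hasDerivAt_id (0 : ℝ)).const_mul (-p)).exp).fun_neg.congr_deriv ?_
    simp
  have hu : Tendsto (fun n : ℕ => 1 / ((n : ℝ) + 1)) atTop (nhdsWithin 0 {0}ᶜ) :=
    tendsto_nhdsWithin_iff.2 ⟨tendsto_one_div_add_atTop_nhds_zero_nat,
      Eventually.of_forall fun n => by simp; positivity⟩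
  refine (hd.tendsto_slope_zero.comp hu).congr fun n => ?_
  simp only [Function.comp, zero_add, one_div, inv_inv, smul_eq_mul, mul_zero, Real.exp_zero,
    ← div_eq_mul_inv]
  ring

/-- every Bernstein function `f` is `p²` times the Laplace transform of some
nonnegative, nondecreasing, concave function `g` (a CrF). -/
theorem bernstein_is_laplace_of_crf (f : ℝ → ℝ) (hf : IsBernstein f) :
    ∃ g : ℝ → ℝ,
      (∀ t : ℝ, 0 ≤ t → 0 ≤ g t) ∧
      MonotoneOn g (Set.Ici 0) ∧
      ConcaveOn ℝ (Set.Ici 0) g ∧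
      ∀ p : ℝ, 0 < p →
        f p = p ^ 2 * ∫ t in Set.Ioi (0 : ℝ), Real.exp (-p * t) * g t := by
  obtain ⟨g, hg, hF⟩ := exists_isCreep_of_tendsto
    (fun n : ℕ => hf.exists_isCreep_comp (x := (n : ℝ) + 1) (by positivity))
    (fun p hp => ((hf.contDiffAt hp 0).continuousAt.tendsto).comp (tendsto_sub_mul_exp p))
  exact ⟨g, hg.nonneg, hg.mono, hg.concave, hF⟩
end

section
/- Let f : (0,∞) → ℝ. Then the following are equivalent: (1) f is a complete Bernstein function and there exists a complete Bernstein function h with f(p) = p^{1/2} h(p) for all p > 0; (2) there exists a complete Bernstein function g with f(p) = p^{1/2} g(p)^{1/2} for all p > 0. That is, 𝔉 ∩ p^{1/2}𝔉 = p^{1/2}𝔉^{1/2}, where 𝔉 denotes the set of complete Bernstein functions. -/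
open MeasureTheory Set Filter

/-- A complete Bernstein function: `f(x) = x² ∫₀^∞ e^{-xt} g(t) dt` for some Bernstein
function `g`. -/
def IsCBF (f : ℝ → ℝ) : Prop :=
  ∃ g : ℝ → ℝ, IsBernstein g ∧
    ∀ x : ℝ, 0 < x → f x = x ^ 2 * ∫ t in Set.Ioi (0 : ℝ), Real.exp (-x * t) * g t

open Topology

/-- The kernel `1 / (s e^{w/2} + (1-s) e^{-w/2})`. -/
noncomputable def stripKernel (w : ℂ) (s : ℝ) : ℂ :=
  (s * Complex.exp (w / 2) + (1 - s) * Complex.exp (-(w / 2)))⁻¹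

/-- The restriction of `stripKernel` to real arguments. -/
noncomputable def lineKernel (v s : ℝ) : ℝ :=
  (s * Real.exp (v / 2) + (1 - s) * Real.exp (-(v / 2)))⁻¹

/-- `ψ` is a mixture of the functions `lineKernel · s`, `s ∈ [0, 1]`. -/
def HasMixtureRep (ψ : ℝ → ℝ) : Prop :=
  ∃ ν : FiniteMeasure unitInterval, ∀ v, ψ v = ∫ s, lineKernel v s ∂(ν : Measure unitInterval)

lemma lineKernel_denom_pos (v : ℝ) {s : ℝ} (hs : s ∈ Icc (0 : ℝ) 1) :
    0 < s * Real.exp (v / 2) + (1 - s) * Real.exp (-(v / 2)) := by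
  have h1 := Real.exp_pos (v / 2)
  have h2 := Real.exp_pos (-(v / 2))
  rcases hs.1.eq_or_lt with h | h
  · rw [← h]; simpa using h2
  · have := mul_nonneg (sub_nonneg.2 hs.2) h2.le
    positivity

lemma continuous_lineKernel (v : ℝ) : Continuous fun s : unitInterval => lineKernel v s := by
  unfold lineKernel
  refine Continuous.inv₀ (by fun_prop) fun s => (lineKernel_denom_pos v s.2).ne'

lemma integrable_unitInterval {E : Type*} [NormedAddCommGroup E]
    (ν : FiniteMeasure unitInterval) {f : unitInterval → E} (hf : Continuous f) :
    Integrable f (ν : Measure unitInterval) := by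
  rw [← integrableOn_univ]
  exact hf.continuousOn.integrableOn_compact isCompact_univ

lemma lineKernel_zero (s : ℝ) : lineKernel 0 s = 1 := by simp [lineKernel]

lemma HasMixtureRep.of_tendsto {ι : Type*} {l : Filter ι} [l.NeBot] {ψs : ι → ℝ → ℝ} {ψ : ℝ → ℝ}
    (h : ∀ᶠ i in l, HasMixtureRep (ψs i))
    (hlim : ∀ v, Tendsto (fun i => ψs i v) l (𝓝 (ψ v))) : HasMixtureRep ψ := by
  classical
  let μ : ι → FiniteMeasure unitInterval := fun i =>
    if hi : HasMixtureRep (ψs i) then hi.choose else 0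
  have hμ : ∀ᶠ i in l, ∀ v, ψs i v = ∫ s, lineKernel v s ∂(μ i : Measure unitInterval) := by
    filter_upwards [h] with i hi
    simpa only [μ, dif_pos hi] using hi.choose_spec
  have hmass : ∀ᶠ i in l, (μ i).mass ≤ Real.toNNReal (ψ 0 + 1) := by
    filter_upwards [hμ, (hlim 0).eventually_lt_const (lt_add_one _)] with i hi hi'
    rw [hi 0] at hi'
    simp only [lineKernel_zero, integral_const, smul_eq_mul, mul_one] at hi'
    rw [← NNReal.coe_le_coe]
    refine le_trans ?_ (Real.le_coe_toNNReal _)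
    exact hi'.le
  have hle : (Ultrafilter.of l : Filter ι) ≤ l := Ultrafilter.of_le l
  obtain ⟨ν, -, hν⟩ := (isCompact_setOfPred_finiteMeasure_le_of_compactSpace unitInterval
    (Real.toNNReal (ψ 0 + 1))).ultrafilter_le_nhds ((Ultrafilter.of l).map μ)
    (by simpa using hle hmass)
  refine ⟨ν, fun v => ?_⟩
  have h1 : Tendsto (fun i => ∫ s, lineKernel v s ∂(μ i : Measure unitInterval))
      (Ultrafilter.of l) (𝓝 (∫ s, lineKernel v s ∂(ν : Measure unitInterval))) :=
    (FiniteMeasure.tendsto_iff_forall_integral_tendsto.1 (show Tendsto μ _ _ from hν))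
      (BoundedContinuousFunction.mkOfCompact ⟨_, continuous_lineKernel v⟩)
  refine tendsto_nhds_unique ((hlim v).mono_left hle) (h1.congr' ?_)
  filter_upwards [hle hμ] with i hi
  exact (hi v).symm

lemma integrable_exp_neg_mul_abs {c : ℝ} (hc : 0 < c) :
    Integrable fun x : ℝ => Real.exp (-c * |x|) := by
  rw [← integrableOn_univ, ← Iic_union_Ioi (a := (0 : ℝ))]
  refine IntegrableOn.union ?_ ?_
  · refine (integrableOn_exp_mul_Iic hc 0).congr_fun (fun x hx => ?_) measurableSet_Iic
    simp [abs_of_nonpos (show x ≤ 0 from hx)]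
  · refine (exp_neg_integrableOn_Ioi 0 hc).congr_fun (fun x hx => ?_) measurableSet_Ioi
    simp [abs_of_pos (show 0 < x from hx)]

lemma exp_half_abs_le_two_mul_cosh (x : ℝ) : Real.exp (|x| / 2) ≤ 2 * Real.cosh (x / 2) := by
  rw [← Real.cosh_abs (x / 2), Real.cosh_eq, abs_div, abs_two]
  have := Real.exp_pos (-(|x| / 2))
  linarith

lemma exp_mul_abs_div_two_cosh_le (a x : ℝ) :
    Real.exp (a * |x|) / (2 * Real.cosh (x / 2)) ≤ Real.exp (-(1 / 2 - a) * |x|) := by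
  have h := Real.cosh_pos (x / 2)
  rw [div_le_iff₀ (by positivity)]
  calc Real.exp (a * |x|) = Real.exp (-(1 / 2 - a) * |x|) * Real.exp (|x| / 2) := by
        rw [← Real.exp_add]; ring_nf
    _ ≤ _ := by gcongr; exact exp_half_abs_le_two_mul_cosh x

lemma integrable_inv_two_cosh : Integrable fun u : ℝ => (2 * Real.cosh (u / 2))⁻¹ := by
  refine (integrable_exp_neg_mul_abs (c := 1 / 2) (by norm_num)).mono' (by
    refine (Continuous.inv₀ (by fun_prop) fun x => ?_).aestronglyMeasurable
    have := Real.cosh_pos (x / 2); positivity) (Eventually.of_forall fun x => ?_)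
  have h := Real.cosh_pos (x / 2)
  rw [Real.norm_of_nonneg (by positivity)]
  simpa using exp_mul_abs_div_two_cosh_le 0 x

lemma integral_inv_two_cosh : ∫ u : ℝ, (2 * Real.cosh (u / 2))⁻¹ = Real.pi := by
  have hd : ∀ u : ℝ, HasDerivAt (fun u => 2 * Real.arctan (Real.exp (u / 2)))
      ((2 * Real.cosh (u / 2))⁻¹) u := by
    intro u
    refine (((((hasDerivAt_id u).div_const 2).exp).arctan).const_mul 2).congr_deriv ?_
    have h := Real.exp_pos (u / 2)
    rw [Real.cosh_eq, Real.exp_neg]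
    simp only [id]
    field_simp
    ring
  rw [integral_of_hasDerivAt_of_tendsto (m := 0) (n := Real.pi) hd integrable_inv_two_cosh]
  · simp
  · have h1 : Tendsto (fun u : ℝ => Real.exp (u / 2)) atBot (𝓝 0) :=
      Real.tendsto_exp_atBot.comp (tendsto_id.atBot_div_const (by norm_num))
    simpa using ((Real.continuous_arctan.tendsto 0).comp h1).const_mul 2
  · have h1 : Tendsto (fun u : ℝ => Real.exp (u / 2)) atTop atTop :=
      Real.tendsto_exp_atTop.comp (tendsto_id.atTop_div_const (by norm_num))
    have := ((Real.tendsto_arctan_atTop.mono_right nhdsWithin_le_nhds).comp h1).const_mul 2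
    rwa [mul_div_cancel₀ _ two_ne_zero] at this

lemma two_sinh_half_ne_zero {w : ℂ} (hw : w ≠ 0) (him : |w.im| < 2 * Real.pi) :
    2 * Complex.sinh (w / 2) ≠ 0 := by
  intro h
  have h1 : Complex.exp w = 1 := by
    rw [Complex.sinh, mul_div_cancel₀ _ two_ne_zero, sub_eq_zero] at h
    calc Complex.exp w = Complex.exp (w / 2) * Complex.exp (w / 2) := by
          rw [← Complex.exp_add, add_halves]
      _ = Complex.exp (w / 2) * Complex.exp (-(w / 2)) := by rw [← h]
      _ = 1 := by rw [← Complex.exp_add, add_neg_cancel, Complex.exp_zero]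
  obtain ⟨n, hn⟩ := Complex.exp_eq_one_iff.1 h1
  have h2 : w.im = n * (2 * Real.pi) := by rw [hn]; simp
  have hn0 : n ≠ 0 := by rintro rfl; simp [hn] at hw
  have h3 : (1 : ℝ) ≤ |(n : ℝ)| := by exact_mod_cast Int.one_le_abs hn0
  rw [h2, abs_mul, abs_of_pos Real.two_pi_pos] at him
  nlinarith [Real.two_pi_pos]

lemma norm_two_sinh_half_ge (w : ℂ) (hw : 2 ≤ |w.re|) :
    Real.exp (|w.re| / 2) / 2 ≤ ‖2 * Complex.sinh (w / 2)‖ := by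
  have h1 : ∀ x : ℝ, Real.exp (|x| / 2) - Real.exp (-(|x| / 2)) ≤
      |Real.exp (x / 2) - Real.exp (-(x / 2))| := by
    intro x
    rcases abs_cases x with ⟨h, -⟩ | ⟨h, -⟩ <;> rw [h]
    · exact le_abs_self _
    · rw [abs_sub_comm]
      refine le_trans (le_of_eq ?_) (le_abs_self _)
      ring_nf
  have h2 : |Real.exp (w.re / 2) - Real.exp (-(w.re / 2))| ≤ ‖2 * Complex.sinh (w / 2)‖ := by
    rw [Complex.sinh, mul_div_cancel₀ _ two_ne_zero]
    refine le_trans (le_of_eq ?_) (abs_norm_sub_norm_le _ _)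
    simp [Complex.norm_exp]
  have h3 : Real.exp (-(|w.re| / 2)) ≤ Real.exp (|w.re| / 2) / 2 := by
    have h4 : 2 ≤ Real.exp |w.re| := by linarith [Real.add_one_le_exp |w.re|]
    have h5 : Real.exp (|w.re| / 2) = Real.exp |w.re| * Real.exp (-(|w.re| / 2)) := by
      rw [← Real.exp_add]; ring_nf
    have := Real.exp_pos (-(|w.re| / 2))
    nlinarith
  linarith [h1 w.re]

lemma two_sinh_half_add_pi_mul_I (x : ℝ) :
    2 * Complex.sinh (((x : ℂ) + Real.pi * Complex.I) / 2) =
      (2 * Real.cosh (x / 2) : ℝ) * Complex.I := by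
  rw [add_div, Complex.sinh_add, mul_div_right_comm, Complex.sinh_mul_I, Complex.cosh_mul_I]
  have h1 : Complex.cos ((Real.pi : ℂ) / 2) = 0 := Complex.cos_pi_div_two
  have h2 : Complex.sin ((Real.pi : ℂ) / 2) = 1 := Complex.sin_pi_div_two
  rw [h1, h2]
  push_cast
  ring

/-- Poisson's formula at `0` for a strip symmetric about the real line, for functions real on
the real line. -/
lemma integral_re_div_two_cosh {Θ : ℂ → ℂ} {b a C : ℝ} (hb : Real.pi < b)
    (hb' : b ≤ 2 * Real.pi) (ha : 0 ≤ a) (ha' : a < 1 / 2)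
    (hd : DifferentiableOn ℂ Θ {w | |w.im| < b}) (hreal : ∀ x : ℝ, (Θ x).im = 0)
    (hC : ∀ w : ℂ, 0 ≤ w.im → w.im ≤ Real.pi → ‖Θ w‖ ≤ C * Real.exp (a * |w.re|)) :
    (Integrable fun u : ℝ => (Θ (u + Real.pi * Complex.I)).re / (2 * Real.cosh (u / 2))) ∧
    ∫ u : ℝ, (Θ (u + Real.pi * Complex.I)).re / (2 * Real.cosh (u / 2)) =
      Real.pi * (Θ 0).re := by
  have hpi := Real.pi_pos
  set S : Set ℂ := {w | |w.im| < b} with hS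
  have hSo : IsOpen S := isOpen_lt (by fun_prop) continuous_const
  have hS0 : (0 : ℂ) ∈ S := by simp [hS]; linarith
  let σ : ℂ → ℂ := fun w => 2 * Complex.sinh (w / 2)
  have hσ : Differentiable ℂ σ := by fun_prop
  have hσ0 : σ 0 = 0 := by simp [σ]
  have hσd : deriv σ 0 = 1 := by
    have : HasDerivAt σ (2 * (Complex.cosh ((0 : ℂ) / 2) * (1 / 2))) 0 :=
      (((hasDerivAt_id (0 : ℂ)).div_const 2).csinh).const_mul 2
    rw [this.deriv]; simp
  let D : ℂ → ℂ := fun w => dslope Θ 0 w / dslope σ 0 w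
  have hDne : ∀ w : ℂ, w ≠ 0 → D w = (Θ w - Θ 0) / σ w := by
    intro w hw
    simp only [D, dslope_of_ne _ hw, slope_def_field, hσ0, sub_zero]
    rw [div_div_div_cancel_right₀ hw]
  have hDd : DifferentiableOn ℂ D S := by
    refine ((Complex.differentiableOn_dslope (hSo.mem_nhds hS0)).2 hd).fun_div
      ((Complex.differentiableOn_dslope (hSo.mem_nhds hS0)).2 hσ.differentiableOn) fun w hw => ?_
    rcases eq_or_ne w 0 with rfl | hw0
    · simp [hσd]
    · rw [dslope_of_ne _ hw0, slope_def_field, hσ0, sub_zero, sub_zero]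
      exact div_ne_zero (two_sinh_half_ne_zero hw0 (lt_of_lt_of_le hw hb')) hw0
  have hC0 : 0 ≤ C := by
    have := hC 0 (by simp) (by simpa using hpi.le)
    simp at this
    exact (norm_nonneg _).trans this
  have hnum : ∀ w : ℂ, 0 ≤ w.im → w.im ≤ Real.pi →
      ‖Θ w - Θ 0‖ ≤ 2 * C * Real.exp (a * |w.re|) := by
    intro w h1 h2
    have h3 := hC 0 (by simp) (by simpa using hpi.le)
    simp only [Complex.zero_re, abs_zero, mul_zero, Real.exp_zero, mul_one] at h3
    have h4 : (1 : ℝ) ≤ Real.exp (a * |w.re|) := Real.one_le_exp (by positivity)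
    have h5 := norm_sub_le (Θ w) (Θ 0)
    have h6 := hC w h1 h2
    nlinarith
  -- the upper side
  have htop : ∀ x : ℝ, (D (x + Real.pi * Complex.I)).im =
      -(((Θ (x + Real.pi * Complex.I)).re - (Θ 0).re) / (2 * Real.cosh (x / 2))) := by
    intro x
    have hc := Real.cosh_pos (x / 2)
    rw [hDne _ (fun h => by simpa [hpi.ne'] using congrArg Complex.im h)]
    simp only [σ]
    rw [two_sinh_half_add_pi_mul_I, div_mul_eq_div_div_swap, Complex.div_I, Complex.div_ofReal_im]
    simp only [Complex.neg_im, Complex.mul_im, Complex.I_re, Complex.I_im, Complex.sub_re,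
      mul_one, mul_zero, add_zero]
    ring
  have hcontTop : Continuous fun x : ℝ => Θ (x + Real.pi * Complex.I) :=
    hd.continuousOn.comp_continuous (by fun_prop) fun x => by
      simp [hS, abs_of_pos hpi, hb]
  have hintTop : Integrable fun x : ℝ =>
      ((Θ (x + Real.pi * Complex.I)).re - (Θ 0).re) / (2 * Real.cosh (x / 2)) := by
    refine ((integrable_exp_neg_mul_abs (c := 1 / 2 - a) (by linarith)).const_mul (2 * C)).mono' ?_
      (Eventually.of_forall fun x => ?_)
    · refine (Continuous.div ((Complex.continuous_re.comp hcontTop).sub continuous_const)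
        (by fun_prop) fun x => ?_).aestronglyMeasurable
      have := Real.cosh_pos (x / 2); positivity
    · have hc := Real.cosh_pos (x / 2)
      rw [Real.norm_eq_abs, abs_div, abs_of_pos (show 0 < 2 * Real.cosh (x / 2) by positivity)]
      have h1 := hnum (x + Real.pi * Complex.I) (by simp [hpi.le]) (by simp)
      have h2 := (Complex.abs_re_le_norm _).trans h1
      simp at h2
      calc _ ≤ 2 * C * Real.exp (a * |x|) / (2 * Real.cosh (x / 2)) := by gcongr
        _ = 2 * C * (Real.exp (a * |x|) / (2 * Real.cosh (x / 2))) := by ring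
        _ ≤ _ := by gcongr; exact exp_mul_abs_div_two_cosh_le a x
  -- the vertical sides
  have hside : ∀ R : ℝ, 2 ≤ |R| → ‖∫ y : ℝ in (0 : ℝ)..Real.pi, D (R + y * Complex.I)‖ ≤
      4 * C * Real.exp (-(1 / 2 - a) * |R|) * Real.pi := by
    intro R hR
    have := intervalIntegral.norm_integral_le_of_norm_le_const (a := 0) (b := Real.pi)
      (f := fun y : ℝ => D (R + y * Complex.I)) (C := 4 * C * Real.exp (-(1 / 2 - a) * |R|)) ?_
    · simpa [abs_of_pos hpi] using this
    intro y hy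
    rw [uIoc_of_le hpi.le] at hy
    have hre : ((R : ℂ) + y * Complex.I).re = R := by simp
    have him : ((R : ℂ) + y * Complex.I).im = y := by simp
    rw [hDne _ (fun h => by
      have := congrArg Complex.re h
      rw [hre] at this
      simp [this] at hR
      linarith), norm_div]
    have h1 := hnum (R + y * Complex.I) (by rw [him]; exact hy.1.le) (by rw [him]; exact hy.2)
    have h2 := norm_two_sinh_half_ge (R + y * Complex.I) (by rwa [hre])
    rw [hre] at h1 h2
    have h3 := Real.exp_pos (|R| / 2)
    rw [div_le_iff₀ (lt_of_lt_of_le (by positivity) h2)]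
    calc _ ≤ 2 * C * Real.exp (a * |R|) := h1
      _ = 4 * C * Real.exp (-(1 / 2 - a) * |R|) * (Real.exp (|R| / 2) / 2) := by
        have : Real.exp (a * |R|) = Real.exp (-(1 / 2 - a) * |R|) * Real.exp (|R| / 2) := by
          rw [← Real.exp_add]; ring_nf
        rw [this]; ring
      _ ≤ _ := by gcongr
  have hrect : ∀ R : ℝ, 0 < R →
      ∫ x in -R..R, ((Θ (x + Real.pi * Complex.I)).re - (Θ 0).re) / (2 * Real.cosh (x / 2)) =
      (∫ y : ℝ in (0 : ℝ)..Real.pi, D ((-R : ℝ) + y * Complex.I)).re -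
        (∫ y : ℝ in (0 : ℝ)..Real.pi, D (R + y * Complex.I)).re := by
    intro R hR
    have hsub : uIcc (-R) R ×ℂ uIcc 0 Real.pi ⊆ S := by
      intro w hw
      rw [Complex.mem_reProdIm, uIcc_of_le hpi.le] at hw
      simp only [hS, mem_ofPred_eq, abs_of_nonneg hw.2.1]
      exact lt_of_le_of_lt hw.2.2 hb
    have hgoursat := Complex.integral_boundary_rect_eq_zero_of_differentiableOn D
      (⟨-R, 0⟩ : ℂ) ⟨R, Real.pi⟩ (hDd.mono hsub)
    simp only [Complex.ofReal_zero, zero_mul, add_zero, smul_eq_mul] at hgoursat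
    have hcb : Continuous fun x : ℝ => D x :=
      hDd.continuousOn.comp_continuous (by fun_prop) fun x => by simp [hS]; linarith
    have hct : Continuous fun x : ℝ => D (x + Real.pi * Complex.I) :=
      hDd.continuousOn.comp_continuous (by fun_prop) fun x => by
        simp [hS, abs_of_pos hpi, hb]
    have hbot0 : (∫ x : ℝ in -R..R, D x).im = 0 := by
      have h1 := Complex.imCLM.intervalIntegral_comp_comm (a := -R) (b := R)
        (hcb.intervalIntegrable (μ := volume) _ _)
      simp only [Complex.imCLM_apply] at h1
      rw [← h1, intervalIntegral.integral_congr_ae (g := fun _ => (0 : ℝ))]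
      · simp
      · have hne : ∀ᵐ x : ℝ, x ≠ 0 := by simp [ae_iff]
        filter_upwards [hne] with x hx _
        rw [hDne _ (by exact_mod_cast hx)]
        have h2 : σ x = ((2 * Real.sinh (x / 2) : ℝ) : ℂ) := by simp [σ]
        have h0 := hreal 0
        rw [Complex.ofReal_zero] at h0
        rw [h2, Complex.div_ofReal_im]
        simp [hreal x, h0]
    have htop' : (∫ x : ℝ in -R..R, D (x + Real.pi * Complex.I)).im =
        -∫ x in -R..R, ((Θ (x + Real.pi * Complex.I)).re - (Θ 0).re) / (2 * Real.cosh (x / 2)) := by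
      have h1 := Complex.imCLM.intervalIntegral_comp_comm (a := -R) (b := R)
        (hct.intervalIntegrable (μ := volume) _ _)
      simp only [Complex.imCLM_apply] at h1
      rw [← h1, ← intervalIntegral.integral_neg]
      exact intervalIntegral.integral_congr fun x _ => htop x
    have := congrArg Complex.im hgoursat
    simp only [Complex.sub_im, Complex.add_im, Complex.I_mul_im, hbot0, htop', Complex.zero_im]
      at this
    linarith
  have hlim0 : Tendsto (fun R : ℝ => 4 * C * Real.exp (-(1 / 2 - a) * |R|) * Real.pi) atTop
      (𝓝 0) := by
    have h1 : Tendsto (fun R : ℝ => -(1 / 2 - a) * |R|) atTop atBot :=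
      (tendsto_abs_atTop_atTop).const_mul_atTop_of_neg (by linarith)
    simpa using ((Real.tendsto_exp_atBot.comp h1).const_mul (4 * C)).mul_const Real.pi
  have hlim1 : Tendsto (fun R : ℝ => ∫ y : ℝ in (0 : ℝ)..Real.pi, D (R + y * Complex.I)) atTop
      (𝓝 0) := by
    refine squeeze_zero_norm' ?_ hlim0
    filter_upwards [eventually_ge_atTop 2] with R hR
    exact hside R (hR.trans (le_abs_self R))
  have hlim2 : Tendsto (fun R : ℝ => ∫ y : ℝ in (0 : ℝ)..Real.pi, D ((-R : ℝ) + y * Complex.I))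
      atTop (𝓝 0) := by
    refine squeeze_zero_norm' ?_ hlim0
    filter_upwards [eventually_ge_atTop 2] with R hR
    simpa only [abs_neg] using hside (-R) (by rw [abs_neg]; exact hR.trans (le_abs_self R))
  have hzero : ∫ x : ℝ, ((Θ (x + Real.pi * Complex.I)).re - (Θ 0).re) / (2 * Real.cosh (x / 2))
      = 0 := by
    refine tendsto_nhds_unique
      (intervalIntegral_tendsto_integral hintTop tendsto_neg_atTop_atBot tendsto_id) ?_
    have h1 := ((Complex.continuous_re.tendsto _).comp hlim2).sub
      ((Complex.continuous_re.tendsto _).comp hlim1)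
    simp only [Complex.zero_re, sub_zero] at h1
    refine h1.congr' ?_
    filter_upwards [eventually_gt_atTop 0] with R hR
    exact (hrect R hR).symm
  have hsplit : ∀ u : ℝ, (Θ (u + Real.pi * Complex.I)).re / (2 * Real.cosh (u / 2)) =
      ((Θ (u + Real.pi * Complex.I)).re - (Θ 0).re) / (2 * Real.cosh (u / 2)) +
        (Θ 0).re * (2 * Real.cosh (u / 2))⁻¹ := fun u => by ring
  simp only [hsplit]
  have hi2 := integrable_inv_two_cosh.const_mul (Θ 0).re
  refine ⟨hintTop.add hi2, ?_⟩
  rw [integral_add hintTop hi2, hzero, integral_const_mul, integral_inv_two_cosh]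
  ring

lemma HasMixtureRep.of_integral {X : Type*} [MeasurableSpace X] {μ : Measure X} {q : X → ℝ}
    {s : X → unitInterval} (hq : Integrable q μ) (hq0 : ∀ x, 0 ≤ q x) (hs : Measurable s) :
    HasMixtureRep fun v => ∫ x, q x * lineKernel v (s x) ∂μ := by
  have hfin : IsFiniteMeasure (μ.withDensity fun x => ((q x).toNNReal : ENNReal)) :=
    isFiniteMeasure_withDensity_ofReal hq.2
  have hfin' : IsFiniteMeasure ((μ.withDensity fun x => ((q x).toNNReal : ENNReal)).map s) :=
    inferInstance
  refine ⟨⟨_, hfin'⟩, fun v => ?_⟩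
  change _ = ∫ t, lineKernel v t ∂((μ.withDensity fun x => ((q x).toNNReal : ENNReal)).map s)
  rw [integral_map hs.aemeasurable
    (continuous_lineKernel v).aestronglyMeasurable,
    integral_withDensity_eq_integral_smul₀ hq.1.aemeasurable.real_toNNReal]
  refine integral_congr_ae (Eventually.of_forall fun x => ?_)
  simp [NNReal.smul_def, hq0 x]

/-- A function on the line extending holomorphically, with nonnegative real part and moderate
growth, to the strip `|Im w| < π` is a mixture of the functions `lineKernel · s`. -/
theorem HasMixtureRep.of_strip {Ψ : ℂ → ℂ} {ψ : ℝ → ℝ}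
    (hd : DifferentiableOn ℂ Ψ {w | |w.im| < Real.pi}) (hreal : ∀ x : ℝ, Ψ x = ψ x)
    (hre : ∀ w : ℂ, 0 ≤ w.im → w.im < Real.pi → 0 ≤ (Ψ w).re)
    (hC : ∀ y < Real.pi, ∃ C, ∀ w : ℂ, 0 ≤ w.im → w.im ≤ y →
      ‖Ψ w‖ ≤ C * Real.exp (|w.re| / 2)) : HasMixtureRep ψ := by
  have hpi := Real.pi_pos
  have key : ∀ α ∈ Ioo (1 / 2 : ℝ) 1, HasMixtureRep fun v => ψ (α * v) := by
    rintro α ⟨hα, hα1⟩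
    have hα0 : 0 < α := by linarith
    have hπα : Real.pi < Real.pi / α := by rw [lt_div_iff₀ hα0]; nlinarith
    obtain ⟨C, hC⟩ := hC (α * Real.pi) (by nlinarith)
    have hC0 : 0 ≤ C := by
      have := hC 0 (by simp) (by simp; positivity)
      simp at this
      exact (norm_nonneg _).trans this
    have hpoisson := fun v : ℝ => integral_re_div_two_cosh (Θ := fun w => Ψ (α * (w + v)))
      (b := Real.pi / α) (a := α / 2) (C := C * Real.exp (α / 2 * |v|)) hπα
      (by rw [div_le_iff₀ hα0]; nlinarith) (by positivity) (by linarith)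
      (hd.comp (by fun_prop) fun w hw => by
        simp only [mem_ofPred_eq] at hw ⊢
        rw [lt_div_iff₀ hα0] at hw
        simpa [abs_mul, abs_of_pos hα0, mul_comm] using hw)
      (fun x => by
        have := hreal (α * (x + v))
        push_cast at this
        rw [this, Complex.ofReal_im])
      (fun w h1 h2 => by
        refine (hC _ (by simp; positivity) (by simp; gcongr)).trans ?_
        rw [mul_assoc, ← Real.exp_add]
        gcongr
        have := abs_add_le w.re v
        simp only [Complex.mul_re, Complex.ofReal_re, Complex.add_re, Complex.ofReal_im, zero_mul,
          sub_zero, abs_mul, abs_of_pos hα0]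
        nlinarith)
    let p : ℝ → ℝ := fun u => (Ψ (α * (u + Real.pi * Complex.I))).re
    let s : ℝ → unitInterval := fun u =>
      ⟨Real.exp (-(u / 2)) / (2 * Real.cosh (u / 2)), by
        have h1 := Real.exp_pos (u / 2)
        have h2 := Real.exp_pos (-(u / 2))
        rw [Real.cosh_eq]
        refine ⟨by positivity, ?_⟩
        rw [div_le_one (by positivity)]
        linarith⟩
    have hs : Measurable s := by
      refine Measurable.subtype_mk (Continuous.measurable (Continuous.div (by fun_prop)
        (by fun_prop) fun u => ?_))
      have := Real.cosh_pos (u / 2); positivity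
    have hq := (hpoisson 0).1
    simp only [Complex.ofReal_zero, add_zero] at hq
    convert HasMixtureRep.of_integral (q := fun u => p u / (2 * Real.cosh (u / 2)) / Real.pi)
      (hq.div_const Real.pi) (fun u => ?_) hs using 2 with v
    · have h1 : (Ψ (α * (0 + v))).re = ψ (α * v) := by
        have := hreal (α * v)
        push_cast at this
        rw [zero_add, this, Complex.ofReal_re]
      have h2 := (hpoisson v).2
      simp only [h1] at h2
      rw [eq_comm, mul_comm, ← eq_div_iff hpi.ne'] at h2
      rw [h2, ← integral_div,
        ← integral_sub_right_eq_self (fun x : ℝ => (Ψ (α * (x + Real.pi * Complex.I + v))).re /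
          (2 * Real.cosh (x / 2)) / Real.pi) v]
      refine integral_congr_ae (Eventually.of_forall fun u => ?_)
      have h3 : (((u - v : ℝ) : ℂ) + Real.pi * Complex.I + v) = u + Real.pi * Complex.I := by
        push_cast; ring
      have hc := Real.cosh_pos (u / 2)
      have h4 : lineKernel v (s u) = 2 * Real.cosh (u / 2) / (2 * Real.cosh ((u - v) / 2)) := by
        have h5 : 2 * Real.cosh ((u - v) / 2) = Real.exp (-(u / 2)) * Real.exp (v / 2) +
            Real.exp (u / 2) * Real.exp (-(v / 2)) := by
          rw [Real.cosh_eq, ← Real.exp_add, ← Real.exp_add]; ring_nf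
        have h6 : 2 * Real.cosh (u / 2) = Real.exp (u / 2) + Real.exp (-(u / 2)) := by
          rw [Real.cosh_eq]; ring
        have h7 : 1 - Real.exp (-(u / 2)) / (2 * Real.cosh (u / 2)) =
            Real.exp (u / 2) / (2 * Real.cosh (u / 2)) := by
          rw [eq_div_iff (by positivity), sub_mul, div_mul_cancel₀ _ (by positivity), h6]; ring
        simp only [lineKernel, s]
        rw [h7, h5, div_mul_eq_mul_div, div_mul_eq_mul_div, ← add_div, inv_div]
      simp only [h3, h4, p]
      field_simp
    · have := Real.cosh_pos (u / 2)
      have : 0 ≤ p u := hre _ (by simp; positivity) (by simp; nlinarith)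
      positivity
  have hcont : Continuous ψ := by
    have h1 : Continuous fun x : ℝ => Ψ x :=
      hd.continuousOn.comp_continuous (by fun_prop) fun x => by simp [hpi]
    have h2 : ψ = fun x : ℝ => (Ψ x).re := by ext x; simp [hreal]
    rw [h2]
    exact Complex.continuous_re.comp h1
  refine HasMixtureRep.of_tendsto (l := 𝓝[<] (1 : ℝ)) (ψs := fun α v => ψ (α * v)) ?_ fun v => ?_
  · filter_upwards [Ioo_mem_nhdsLT (show (1 / 2 : ℝ) < 1 by norm_num)] with α hα using key α hα
  · have : Tendsto (fun α : ℝ => ψ (α * v)) (𝓝 1) (𝓝 (ψ (1 * v))) :=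
      Continuous.tendsto (by fun_prop) 1
    rw [one_mul] at this
    exact this.mono_left nhdsWithin_le_nhds

/-- The denominator of `stripKernel`. -/
noncomputable def stripDenom (w : ℂ) (s : ℝ) : ℂ :=
  s * Complex.exp (w / 2) + (1 - s) * Complex.exp (-(w / 2))

lemma stripKernel_eq_inv (w : ℂ) (s : ℝ) : stripKernel w s = (stripDenom w s)⁻¹ := rfl

lemma stripDenom_re (w : ℂ) (s : ℝ) : (stripDenom w s).re =
    (s * Real.exp (w.re / 2) + (1 - s) * Real.exp (-(w.re / 2))) * Real.cos (w.im / 2) := by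
  simp [stripDenom, Complex.exp_re, Complex.exp_im]
  ring

lemma stripDenom_im (w : ℂ) (s : ℝ) : (stripDenom w s).im =
    (s * Real.exp (w.re / 2) - (1 - s) * Real.exp (-(w.re / 2))) * Real.sin (w.im / 2) := by
  simp [stripDenom, Complex.exp_re, Complex.exp_im]
  ring

lemma stripKernel_ofReal (v s : ℝ) : stripKernel v s = lineKernel v s := by
  simp [stripKernel, lineKernel]

lemma cos_half_pos {y : ℝ} (hy : |y| < Real.pi) : 0 < Real.cos (y / 2) := by
  have := abs_lt.1 hy
  exact Real.cos_pos_of_mem_Ioo ⟨by linarith, by linarith⟩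

lemma stripDenom_re_pos {w : ℂ} (hw : |w.im| < Real.pi) {s : ℝ} (hs : s ∈ Icc (0 : ℝ) 1) :
    0 < (stripDenom w s).re := by
  rw [stripDenom_re]
  exact mul_pos (lineKernel_denom_pos _ hs) (cos_half_pos hw)

lemma stripDenom_ne_zero {w : ℂ} (hw : |w.im| < Real.pi) {s : ℝ} (hs : s ∈ Icc (0 : ℝ) 1) :
    stripDenom w s ≠ 0 := fun h => by
  simpa [h] using stripDenom_re_pos hw hs

lemma stripKernel_re_pos {w : ℂ} (hw : |w.im| < Real.pi) {s : ℝ} (hs : s ∈ Icc (0 : ℝ) 1) :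
    0 < (stripKernel w s).re := by
  rw [stripKernel_eq_inv, Complex.inv_re]
  exact div_pos (stripDenom_re_pos hw hs) (Complex.normSq_pos.2 (stripDenom_ne_zero hw hs))

lemma stripKernel_upper {w : ℂ} (h0 : 0 ≤ w.im) (hw : w.im < Real.pi) {s : ℝ}
    (hs : s ∈ Icc (0 : ℝ) 1) :
    0 ≤ Real.cos (w.im / 2) * (stripKernel w s).im + Real.sin (w.im / 2) * (stripKernel w s).re ∧
    Real.cos (w.im / 2) * (stripKernel w s).im - Real.sin (w.im / 2) * (stripKernel w s).re ≤ 0 := by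
  have hc := cos_half_pos (show |w.im| < Real.pi by rwa [abs_of_nonneg h0])
  have hsin : 0 ≤ Real.sin (w.im / 2) :=
    Real.sin_nonneg_of_nonneg_of_le_pi (by linarith) (by linarith [Real.pi_pos])
  have hn := Complex.normSq_nonneg (stripDenom w s)
  have hs0 : 0 ≤ s := hs.1
  have hs1 : 0 ≤ 1 - s := sub_nonneg.2 hs.2
  rw [stripKernel_eq_inv, Complex.inv_re, Complex.inv_im, stripDenom_re, stripDenom_im]
  constructor
  · have : 0 ≤ 2 * ((1 - s) * Real.exp (-(w.re / 2))) * (Real.cos (w.im / 2) *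
        Real.sin (w.im / 2)) / Complex.normSq (stripDenom w s) := by positivity
    refine this.trans_eq ?_
    ring
  · have : 0 ≤ 2 * (s * Real.exp (w.re / 2)) * (Real.cos (w.im / 2) *
        Real.sin (w.im / 2)) / Complex.normSq (stripDenom w s) := by positivity
    rw [← neg_nonneg]
    refine this.trans_eq ?_
    ring

lemma norm_stripKernel_mul_cos_le {w : ℂ} (hw : |w.im| < Real.pi) {s : ℝ}
    (hs : s ∈ Icc (0 : ℝ) 1) :
    ‖stripKernel w s‖ * Real.cos (w.im / 2) ≤ Real.exp (|w.re| / 2) := by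
  have hc := cos_half_pos hw
  have h1 : Real.exp (-(|w.re| / 2)) ≤
      s * Real.exp (w.re / 2) + (1 - s) * Real.exp (-(w.re / 2)) := by
    have h2 : Real.exp (-(|w.re| / 2)) ≤ Real.exp (w.re / 2) :=
      Real.exp_le_exp.2 (by linarith [neg_abs_le w.re])
    have h3 : Real.exp (-(|w.re| / 2)) ≤ Real.exp (-(w.re / 2)) :=
      Real.exp_le_exp.2 (by linarith [le_abs_self w.re])
    have := mul_le_mul_of_nonneg_left h2 hs.1
    have := mul_le_mul_of_nonneg_left h3 (sub_nonneg.2 hs.2)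
    linarith
  have h4 : Real.exp (-(|w.re| / 2)) * Real.cos (w.im / 2) ≤ ‖stripDenom w s‖ := by
    refine le_trans ?_ (Complex.re_le_norm _)
    rw [stripDenom_re]
    gcongr
  rw [stripKernel_eq_inv, norm_inv, inv_mul_le_iff₀ (norm_pos_iff.2 (stripDenom_ne_zero hw hs))]
  calc Real.cos (w.im / 2)
      = Real.exp (-(|w.re| / 2)) * Real.cos (w.im / 2) * Real.exp (|w.re| / 2) := by
        rw [mul_right_comm, ← Real.exp_add, neg_add_cancel, Real.exp_zero, one_mul]
    _ ≤ _ := by gcongr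

lemma isOpen_strip : IsOpen {w : ℂ | |w.im| < Real.pi} :=
  isOpen_lt (by fun_prop) continuous_const

lemma continuous_stripKernel {w : ℂ} (hw : |w.im| < Real.pi) :
    Continuous fun s : unitInterval => stripKernel w s := by
  unfold stripKernel
  exact Continuous.inv₀ (by fun_prop) fun s => stripDenom_ne_zero hw s.2

lemma differentiableOn_integral_stripKernel (ν : FiniteMeasure unitInterval) :
    DifferentiableOn ℂ (fun w => ∫ s, stripKernel w s ∂(ν : Measure unitInterval))
      {w | |w.im| < Real.pi} := by
  intro w₀ hw₀
  obtain ⟨ε, hε, hball⟩ := Metric.nhds_basis_closedBall.mem_iff.1 (isOpen_strip.mem_nhds hw₀)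
  let K' : ℂ → ℝ → ℂ := fun w s =>
    -(s * (Complex.exp (w / 2) * (1 / 2)) + (1 - s) * (Complex.exp (-(w / 2)) * -(1 / 2))) /
      stripDenom w s ^ 2
  have hcont : ContinuousOn (fun p : ℂ × unitInterval => K' p.1 p.2)
      (Metric.closedBall w₀ ε ×ˢ univ) := by
    refine ContinuousOn.div (by fun_prop) ?_ fun p hp =>
      pow_ne_zero 2 (stripDenom_ne_zero (hball hp.1) p.2.2)
    unfold stripDenom
    fun_prop
  obtain ⟨B, hB⟩ := ((isCompact_closedBall w₀ ε).prod isCompact_univ).exists_bound_of_continuousOn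
    hcont
  refine (hasDerivAt_integral_of_dominated_loc_of_deriv_le (F := fun w (s : unitInterval) =>
    stripKernel w s) (F' := fun w (s : unitInterval) => K' w s) (bound := fun _ => B)
    (Metric.closedBall_mem_nhds w₀ hε) ?_ (integrable_unitInterval ν (continuous_stripKernel hw₀))
    ?_ ?_ (integrable_const _) ?_).2.differentiableAt.differentiableWithinAt
  · filter_upwards [isOpen_strip.mem_nhds hw₀] with w hw
    exact (continuous_stripKernel hw).aestronglyMeasurable
  · refine Continuous.aestronglyMeasurable ?_
    exact hcont.comp_continuous (f := fun s : unitInterval => (w₀, s)) (by fun_prop) fun s =>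
      ⟨Metric.mem_closedBall_self hε.le, mem_univ _⟩
  · exact Eventually.of_forall fun s w hw => hB (w, s) ⟨hw, mem_univ _⟩
  · refine Eventually.of_forall fun s w hw => ?_
    have h1 : HasDerivAt (fun w : ℂ => w / 2) (1 / 2) w := (hasDerivAt_id w).div_const 2
    exact (((h1.cexp).const_mul (s : ℂ)).add ((h1.fun_neg.cexp).const_mul (1 - (s : ℂ)))).inv
      (stripDenom_ne_zero (hball hw) s.2)

/-- A mixture of the functions `lineKernel · s` extends holomorphically to the strip
`|Im w| < π`, with values in a sector. -/
theorem HasMixtureRep.exists_extension {ψ : ℝ → ℝ} (h : HasMixtureRep ψ) :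
    ∃ Ψ : ℂ → ℂ, DifferentiableOn ℂ Ψ {w | |w.im| < Real.pi} ∧ (∀ x : ℝ, Ψ x = ψ x) ∧
      (∀ w : ℂ, |w.im| < Real.pi → 0 ≤ (Ψ w).re) ∧
      (ψ = 0 ∨ ∀ w : ℂ, |w.im| < Real.pi → 0 < (Ψ w).re) ∧
      (∃ M, ∀ w : ℂ, |w.im| < Real.pi →
        ‖Ψ w‖ * Real.cos (w.im / 2) ≤ M * Real.exp (|w.re| / 2)) ∧
      ∀ w : ℂ, 0 ≤ w.im → w.im < Real.pi →
        0 ≤ Real.cos (w.im / 2) * (Ψ w).im + Real.sin (w.im / 2) * (Ψ w).re ∧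
        Real.cos (w.im / 2) * (Ψ w).im - Real.sin (w.im / 2) * (Ψ w).re ≤ 0 := by
  obtain ⟨ν, hν⟩ := h
  have hint : ∀ {w : ℂ}, |w.im| < Real.pi →
      Integrable (fun s : unitInterval => stripKernel w s) (ν : Measure unitInterval) :=
    fun hw => integrable_unitInterval ν (continuous_stripKernel hw)
  have hre : ∀ {w : ℂ}, |w.im| < Real.pi → (∫ s, stripKernel w s ∂(ν : Measure unitInterval)).re =
      ∫ s, (stripKernel w s).re ∂(ν : Measure unitInterval) := fun hw => (integral_re (hint hw)).symm
  have him : ∀ {w : ℂ}, |w.im| < Real.pi → (∫ s, stripKernel w s ∂(ν : Measure unitInterval)).im =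
      ∫ s, (stripKernel w s).im ∂(ν : Measure unitInterval) := fun hw => (integral_im (hint hw)).symm
  refine ⟨fun w => ∫ s, stripKernel w s ∂(ν : Measure unitInterval),
    differentiableOn_integral_stripKernel ν, fun x => ?_, fun w hw => ?_, ?_,
    ⟨(ν : Measure unitInterval).real univ, fun w hw => ?_⟩, fun w h0 hw => ?_⟩
  · simp only [stripKernel_ofReal]
    rw [integral_complex_ofReal, hν]
  · rw [hre hw]
    exact integral_nonneg fun s => (stripKernel_re_pos hw s.2).le
  · rcases eq_or_ne ν 0 with h0 | h0
    · left
      ext v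
      simp [hν, h0]
    · right
      intro w hw
      rw [hre hw, integral_pos_iff_support_of_nonneg (fun s => (stripKernel_re_pos hw s.2).le)
        (hint hw).re]
      have : Function.support (fun s : unitInterval => (stripKernel w s).re) = univ :=
        eq_univ_of_forall fun s => (stripKernel_re_pos hw s.2).ne'
      rw [this, pos_iff_ne_zero, Ne, Measure.measure_univ_eq_zero]
      exact fun h => h0 (Subtype.ext h)
  · have hc := cos_half_pos hw
    rw [← le_div_iff₀ hc]
    have := norm_integral_le_of_norm_le_const (μ := (ν : Measure unitInterval))
      (f := fun s : unitInterval => stripKernel w s)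
      (C := Real.exp (|w.re| / 2) / Real.cos (w.im / 2)) (Eventually.of_forall fun s => by
        rw [le_div_iff₀ hc]
        exact norm_stripKernel_mul_cos_le hw s.2)
    refine this.trans_eq ?_
    ring
  · have hw' : |w.im| < Real.pi := by rwa [abs_of_nonneg h0]
    have i1 : Integrable (fun s : unitInterval => (stripKernel w s).re) (ν : Measure unitInterval) :=
      (hint hw').re
    have i2 : Integrable (fun s : unitInterval => (stripKernel w s).im) (ν : Measure unitInterval) :=
      (hint hw').im
    simp only [hre hw', him hw', ← integral_const_mul]
    constructor
    · rw [← integral_add (i2.const_mul _) (i1.const_mul _)]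
      exact integral_nonneg fun s => (stripKernel_upper h0 hw s.2).1
    · rw [← integral_sub (i2.const_mul _) (i1.const_mul _)]
      exact integral_nonpos fun s => (stripKernel_upper h0 hw s.2).2

lemma hasMixtureRep_zero : HasMixtureRep fun _ => 0 := ⟨0, fun v => by simp⟩

lemma norm_le_of_mul_cos_le {Ψ : ℂ → ℂ} {M : ℝ} (hM : ∀ w : ℂ, |w.im| < Real.pi →
    ‖Ψ w‖ * Real.cos (w.im / 2) ≤ M * Real.exp (|w.re| / 2)) {y : ℝ} (hy : y < Real.pi)
    {w : ℂ} (h0 : 0 ≤ w.im) (hw : w.im ≤ y) :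
    ‖Ψ w‖ ≤ M / Real.cos (y / 2) * Real.exp (|w.re| / 2) := by
  have hc : 0 < Real.cos (y / 2) := cos_half_pos (by rw [abs_of_nonneg (h0.trans hw)]; exact hy)
  have h1 : Real.cos (y / 2) ≤ Real.cos (w.im / 2) :=
    Real.cos_le_cos_of_nonneg_of_le_pi (by linarith) (by linarith) (by linarith)
  have h2 := hM w (by rw [abs_of_nonneg h0]; linarith)
  rw [div_mul_eq_mul_div, le_div_iff₀ hc]
  exact (mul_le_mul_of_nonneg_left h1 (norm_nonneg _)).trans h2

lemma HasMixtureRep.exp_mul_sqrt {ψ : ℝ → ℝ} (h : HasMixtureRep ψ) {c : ℝ} (hc : |c| ≤ 1 / 4) :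
    HasMixtureRep fun v => Real.exp (c * v) * √(ψ v) := by
  obtain ⟨Ψ, hd, hreal, -, hpos | hpos, ⟨M, hM⟩, -⟩ := h.exists_extension
  · simpa [hpos] using hasMixtureRep_zero
  have hpi := Real.pi_pos
  have hlog : ∀ w : ℂ, ‖Complex.exp (c * w + Complex.log (Ψ w) / 2)‖ =
      Real.exp (c * w.re + Real.log ‖Ψ w‖ / 2) := fun w => by
    simp [Complex.norm_exp, Complex.log_re]
  have hsqrt : ∀ {r : ℝ}, 0 < r → Real.exp (Real.log r / 2) = √r := fun hr => by
    rw [Real.exp_half, Real.exp_log hr]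
  refine HasMixtureRep.of_strip (Ψ := fun w => Complex.exp (c * w + Complex.log (Ψ w) / 2))
    ?_ (fun x => ?_) (fun w h0 hw => ?_) fun y hy => ?_
  · refine DifferentiableOn.cexp (DifferentiableOn.add (by fun_prop) (DifferentiableOn.div_const
      (hd.clog fun w hw => ?_) _))
    exact Or.inl (hpos w hw)
  · have hx : 0 < ψ x := by simpa [hreal] using hpos x (by simpa using hpi)
    rw [hreal, ← Complex.ofReal_log hx.le, ← hsqrt hx, ← Real.exp_add]
    push_cast
    rfl
  · have h1 := hpos w (by rwa [abs_of_nonneg h0])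
    have h2 := Complex.abs_arg_lt_pi_div_two_iff.2 (Or.inl h1)
    rw [Complex.exp_re]
    refine mul_nonneg (Real.exp_pos _).le (Real.cos_nonneg_of_mem_Icc ?_)
    have h3 : (c * w + Complex.log (Ψ w) / 2).im = c * w.im + (Ψ w).arg / 2 := by
      simp [Complex.log_im]
    rw [h3]
    have h4 := abs_le.1 hc
    have h5 := abs_lt.1 h2
    constructor <;> nlinarith
  · refine ⟨√(M / Real.cos (y / 2)), fun w h0 hw => ?_⟩
    have h1 := hpos w (by rw [abs_of_nonneg h0]; linarith)
    have h2 : 0 < ‖Ψ w‖ := norm_pos_iff.2 fun h => by simp [h] at h1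
    rw [hlog, Real.exp_add, hsqrt h2]
    have h3 := Real.sqrt_le_sqrt (norm_le_of_mul_cos_le hM hy h0 hw)
    rw [Real.sqrt_mul' _ (Real.exp_pos _).le, ← Real.exp_half] at h3
    have h4 : Real.exp (c * w.re) ≤ Real.exp (|w.re| / 2 / 2) := by
      refine Real.exp_le_exp.2 ((le_abs_self _).trans ?_)
      rw [abs_mul]
      nlinarith [abs_nonneg w.re]
    calc _ ≤ Real.exp (|w.re| / 2 / 2) * (√(M / Real.cos (y / 2)) * Real.exp (|w.re| / 2 / 2)) := by
          gcongr
      _ = _ := by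
          rw [mul_left_comm, ← Real.exp_add, add_halves]

lemma convex_strip : Convex ℝ {w : ℂ | |w.im| < Real.pi} := by
  have : {w : ℂ | |w.im| < Real.pi} = Complex.imLm ⁻¹' Ioo (-Real.pi) Real.pi := by
    ext w; simp [abs_lt]
  rw [this]
  exact (convex_Ioo _ _).linear_preimage _

lemma eqOn_strip_of_eq_ofReal {F G : ℂ → ℂ} (hF : DifferentiableOn ℂ F {w | |w.im| < Real.pi})
    (hG : DifferentiableOn ℂ G {w | |w.im| < Real.pi}) (h : ∀ x : ℝ, F x = G x) :
    EqOn F G {w | |w.im| < Real.pi} := by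
  refine (hF.analyticOnNhd isOpen_strip).eqOn_of_preconnected_of_frequently_eq
    (hG.analyticOnNhd isOpen_strip) convex_strip.isPreconnected (z₀ := 0)
    (by simpa using Real.pi_pos) ?_
  have h1 : Tendsto (fun x : ℝ => (x : ℂ)) (𝓝[≠] 0) (𝓝[≠] 0) := by
    refine tendsto_nhdsWithin_iff.2 ⟨?_, ?_⟩
    · exact (Complex.continuous_ofReal.tendsto' 0 0 rfl).mono_left nhdsWithin_le_nhds
    · filter_upwards [self_mem_nhdsWithin] with x hx
      simpa using hx
  exact h1.frequently (Frequently.of_forall h)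

lemma HasMixtureRep.exp_mul_sq {ψ : ℝ → ℝ} (h : HasMixtureRep ψ)
    (h' : HasMixtureRep fun v => Real.exp (v / 2) * ψ v) :
    HasMixtureRep fun v => Real.exp (v / 2) * ψ v ^ 2 := by
  obtain ⟨Ψ, hd, hreal, hre, -, ⟨M, hM⟩, him⟩ := h.exists_extension
  obtain ⟨F, hFd, hFreal, -, -, ⟨N, hN⟩, hFim⟩ := h'.exists_extension
  have hF : ∀ w : ℂ, |w.im| < Real.pi → F w = Complex.exp (w / 2) * Ψ w := fun w hw =>
    eqOn_strip_of_eq_ofReal hFd (G := fun w => Complex.exp (w / 2) * Ψ w)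
      (DifferentiableOn.mul (by fun_prop) hd) (fun x => by simp [hFreal, hreal]) hw
  refine HasMixtureRep.of_strip (Ψ := fun w => Complex.exp (w / 2) * Ψ w ^ 2)
    (DifferentiableOn.mul (by fun_prop) (hd.pow 2)) (fun x => by simp [hreal])
    (fun w h0 hw => ?_) fun y hy => ?_
  · have hw' : |w.im| < Real.pi := by rwa [abs_of_nonneg h0]
    have h1 := (him w h0 hw).1
    have h2 := (hFim w h0 hw).2
    have h3 := hre w hw'
    have hexp := Real.exp_pos (w.re / 2)
    have hC := cos_half_pos hw'
    have hS : 0 ≤ Real.sin (w.im / 2) :=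
      Real.sin_nonneg_of_nonneg_of_le_pi (by linarith) (by linarith)
    have hCS := Real.sin_sq_add_cos_sq (w.im / 2)
    have hsplit : Complex.exp (w / 2) = Real.exp (w.re / 2) *
        (Real.cos (w.im / 2) + Real.sin (w.im / 2) * Complex.I) := by
      apply Complex.ext <;> simp [Complex.exp_re, Complex.exp_im, -Complex.ofReal_exp,
        -Complex.ofReal_cos, -Complex.ofReal_sin]
    rw [hF w hw', hsplit] at h2
    rw [hsplit]
    generalize Real.cos (w.im / 2) = C at *
    generalize Real.sin (w.im / 2) = S at *
    generalize Real.exp (w.re / 2) = E at *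
    generalize hΨ : Ψ w = z at *
    obtain ⟨x, y⟩ := z
    simp only [Complex.mul_im, Complex.mul_re, Complex.add_re, Complex.add_im, Complex.ofReal_re,
      Complex.ofReal_im, Complex.I_re, Complex.I_im, pow_two] at h1 h2 h3 ⊢
    have hy : y ≤ 0 := by
      have : E * y ≤ 0 := by
        calc E * y = E * y * (S ^ 2 + C ^ 2) := by rw [hCS, mul_one]
          _ ≤ 0 := by linarith
      by_contra! hy
      exact absurd this (not_le.2 (mul_pos hexp hy))
    have h4 : 0 ≤ C * (x * x - y * y) - 2 * S * x * y := by
      nlinarith [mul_nonneg (neg_nonneg.2 hy) h1, mul_nonneg hC.le (mul_self_nonneg x),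
        mul_nonneg hC.le (mul_self_nonneg y)]
    have h5 := mul_nonneg hexp.le h4
    linarith
  · set K := Real.cos (y / 2)
    refine ⟨max ((M / K) ^ 2) ((N / K) ^ 2), fun w h0 hw => ?_⟩
    have hw' : |w.im| < Real.pi := by rw [abs_of_nonneg h0]; linarith
    have h1 := norm_le_of_mul_cos_le hM hy h0 hw
    have h2 := norm_le_of_mul_cos_le hN hy h0 hw
    have hnE : ‖Complex.exp (w / 2)‖ = Real.exp (w.re / 2) := by simp [Complex.norm_exp]
    have hsq : ∀ r : ℝ, Real.exp (r / 2) ^ 2 = Real.exp r := fun r => by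
      rw [← Real.exp_nat_mul]; congr 1; push_cast; ring
    have h1' := pow_le_pow_left₀ (norm_nonneg _) h1 2
    have h2' := pow_le_pow_left₀ (norm_nonneg _) h2 2
    rw [mul_pow, hsq] at h1' h2'
    rcases le_total w.re 0 with hr | hr
    · calc ‖Complex.exp (w / 2) * Ψ w ^ 2‖ = Real.exp (w.re / 2) * ‖Ψ w‖ ^ 2 := by
            rw [norm_mul, norm_pow, hnE]
        _ ≤ Real.exp (w.re / 2) * ((M / K) ^ 2 * Real.exp |w.re|) := by gcongr
        _ = (M / K) ^ 2 * Real.exp (|w.re| / 2) := by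
            rw [mul_left_comm, ← Real.exp_add, abs_of_nonpos hr]; ring_nf
        _ ≤ _ := by gcongr; exact le_max_left _ _
    · have h3 : Complex.exp (w / 2) * Ψ w ^ 2 = Complex.exp (-(w / 2)) * F w ^ 2 := by
        rw [hF w hw', mul_pow, ← mul_assoc, pow_two (Complex.exp (w / 2)), ← mul_assoc,
          ← Complex.exp_add, neg_add_cancel, Complex.exp_zero, one_mul]
      calc ‖Complex.exp (w / 2) * Ψ w ^ 2‖ = Real.exp (-(w.re / 2)) * ‖F w‖ ^ 2 := by
            rw [h3, norm_mul, norm_pow]; simp [Complex.norm_exp]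
        _ ≤ Real.exp (-(w.re / 2)) * ((N / K) ^ 2 * Real.exp |w.re|) := by gcongr
        _ = (N / K) ^ 2 * Real.exp (|w.re| / 2) := by
            rw [mul_left_comm, ← Real.exp_add, abs_of_nonneg hr]; ring_nf
        _ ≤ _ := by gcongr; exact le_max_right _ _

lemma IsBernstein.of_hasDerivAt {g : ℝ → ℝ} {G : ℕ → ℝ → ℝ} (h0 : ∀ t, 0 ≤ t → 0 ≤ g t)
    (hc : ContinuousOn g (Ici 0)) (hg : ∀ t, 0 < t → HasDerivAt g (G 0 t) t)
    (hG : ∀ n t, 0 < t → HasDerivAt (G n) (-G (n + 1) t) t) (hG0 : ∀ n t, 0 < t → 0 ≤ G n t) :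
    IsBernstein g := by
  have hder : ∀ n, ∀ t ∈ Ioi (0 : ℝ),
      iteratedDerivWithin (n + 1) g (Ioi 0) t = (-1) ^ n * G n t := by
    intro n
    induction n with
    | zero =>
      intro t ht
      rw [zero_add, iteratedDerivWithin_one, derivWithin_of_isOpen isOpen_Ioi ht, (hg t ht).deriv]
      simp
    | succ n ih =>
      intro t ht
      rw [iteratedDerivWithin_succ, derivWithin_congr ih (ih t ht),
        derivWithin_of_isOpen isOpen_Ioi ht, ((hG n t ht).const_mul _).deriv]
      ring
  refine ⟨h0, hc, contDiffOn_of_differentiableOn_deriv fun m _ => ?_, fun n hn t ht => ?_⟩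
  · cases m with
    | zero =>
      rw [iteratedDerivWithin_zero]
      exact fun t ht => (hg t ht).differentiableAt.differentiableWithinAt
    | succ m =>
      exact DifferentiableOn.congr (fun t ht =>
        ((hG m t ht).const_mul _).differentiableAt.differentiableWithinAt) (hder m)
  · obtain ⟨n, rfl⟩ := Nat.exists_eq_add_of_le' hn
    rw [hder n t ht, Nat.add_sub_cancel, ← mul_assoc, ← mul_pow]
    simpa using hG0 n t ht

/-- The Bernstein functions whose Laplace transforms are `1 / (x (s x + 1 - s))`. -/
noncomputable def bernsteinKernel (s t : ℝ) : ℝ :=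
  if s = 0 then 1 else if s = 1 then t else (1 - Real.exp (-t * (s⁻¹ - 1))) / (1 - s)

/-- Up to the sign `(-1) ^ n`, the derivative of order `n + 1` of `bernsteinKernel s`. -/
noncomputable def bernsteinKernelDeriv (n : ℕ) (s t : ℝ) : ℝ :=
  s⁻¹ * (s⁻¹ - 1) ^ n * Real.exp (-t * (s⁻¹ - 1))

lemma bernsteinKernel_mem {s t : ℝ} (hs : s ∈ Icc (0 : ℝ) 1) (ht : 0 ≤ t) :
    bernsteinKernel s t ∈ Icc 0 (2 * (1 + t)) := by
  unfold bernsteinKernel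
  split_ifs with h0 h1
  · exact ⟨zero_le_one, by linarith⟩
  · exact ⟨ht, by linarith⟩
  have hs0 : 0 < s := lt_of_le_of_ne hs.1 (Ne.symm h0)
  have hs1 : 0 < 1 - s := sub_pos.2 (lt_of_le_of_ne hs.2 h1)
  have hq : 0 ≤ t * (s⁻¹ - 1) := mul_nonneg ht (sub_nonneg.2 ((one_le_inv₀ hs0).2 hs.2))
  have he1 : Real.exp (-t * (s⁻¹ - 1)) ≤ 1 := Real.exp_le_one_iff.2 (by linarith)
  refine ⟨div_nonneg (by linarith) hs1.le, ?_⟩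
  rw [div_le_iff₀ hs1]
  rcases le_total s (1 / 2) with h | h
  · have := Real.exp_pos (-t * (s⁻¹ - 1))
    nlinarith
  · have h2 := Real.add_one_le_exp (-t * (s⁻¹ - 1))
    have h3 : s⁻¹ - 1 = (1 - s) * s⁻¹ := by field_simp
    have h4 : s⁻¹ ≤ 2 := by rw [inv_le_comm₀ hs0 two_pos]; linarith
    have h5 : t * (s⁻¹ - 1) ≤ t * ((1 - s) * 2) := by rw [h3]; gcongr
    nlinarith

lemma measurable_bernsteinKernel : Measurable fun p : ℝ × ℝ => bernsteinKernel p.1 p.2 := by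
  unfold bernsteinKernel
  refine Measurable.ite (measurableSet_eq_fun (by fun_prop) (by fun_prop)) (by fun_prop)
    (Measurable.ite (measurableSet_eq_fun (by fun_prop) (by fun_prop)) (by fun_prop)
      (by fun_prop))

lemma measurable_bernsteinKernelDeriv (n : ℕ) (t : ℝ) :
    Measurable fun s => bernsteinKernelDeriv n s t := by
  unfold bernsteinKernelDeriv
  fun_prop

lemma continuous_bernsteinKernel (s : ℝ) : Continuous (bernsteinKernel s) := by
  unfold bernsteinKernel
  split_ifs <;> fun_prop

lemma hasDerivAt_bernsteinKernel (s t : ℝ) :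
    HasDerivAt (bernsteinKernel s) (bernsteinKernelDeriv 0 s t) t := by
  unfold bernsteinKernel bernsteinKernelDeriv
  split_ifs with h0 h1
  · simpa [h0] using hasDerivAt_const t (1 : ℝ)
  · simpa [h1] using hasDerivAt_id' t
  · have hs : 1 - s ≠ 0 := sub_ne_zero.2 (Ne.symm h1)
    refine (((((hasDerivAt_neg' t).mul_const (s⁻¹ - 1)).exp).const_sub 1).div_const
      (1 - s)).congr_deriv ?_
    field_simp

lemma hasDerivAt_bernsteinKernelDeriv (n : ℕ) (s t : ℝ) :
    HasDerivAt (bernsteinKernelDeriv n s) (-bernsteinKernelDeriv (n + 1) s t) t := by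
  unfold bernsteinKernelDeriv
  refine ((((hasDerivAt_neg' t).mul_const (s⁻¹ - 1)).exp).const_mul
    (s⁻¹ * (s⁻¹ - 1) ^ n)).congr_deriv ?_
  ring

lemma pow_mul_exp_neg_le (m : ℕ) {a q : ℝ} (ha : 0 < a) (hq : 0 ≤ q) :
    q ^ m * Real.exp (-a * q) ≤ m.factorial / a ^ m := by
  have h1 := Real.pow_div_factorial_le_exp (a * q) (by positivity) m
  rw [div_le_iff₀ (by positivity)] at h1
  rw [neg_mul, Real.exp_neg, ← div_eq_mul_inv, div_le_div_iff₀ (Real.exp_pos _) (by positivity),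
    ← mul_pow, mul_comm q]
  linarith

lemma bernsteinKernelDeriv_mem (n : ℕ) {s a t : ℝ} (hs : s ∈ Icc (0 : ℝ) 1) (ha : 0 < a)
    (ht : a ≤ t) : bernsteinKernelDeriv n s t ∈
      Icc 0 (n.factorial / a ^ n + (n + 1).factorial / a ^ (n + 1)) := by
  unfold bernsteinKernelDeriv
  rcases hs.1.eq_or_lt with h0 | h0
  · rw [← h0]
    simp only [inv_zero, zero_mul]
    exact ⟨le_rfl, by positivity⟩
  have hq : 0 ≤ s⁻¹ - 1 := sub_nonneg.2 ((one_le_inv₀ h0).2 hs.2)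
  refine ⟨by positivity, ?_⟩
  have h1 : Real.exp (-t * (s⁻¹ - 1)) ≤ Real.exp (-a * (s⁻¹ - 1)) :=
    Real.exp_le_exp.2 (by nlinarith)
  calc s⁻¹ * (s⁻¹ - 1) ^ n * Real.exp (-t * (s⁻¹ - 1))
      ≤ s⁻¹ * (s⁻¹ - 1) ^ n * Real.exp (-a * (s⁻¹ - 1)) := by gcongr
    _ = (s⁻¹ - 1) ^ n * Real.exp (-a * (s⁻¹ - 1)) +
        (s⁻¹ - 1) ^ (n + 1) * Real.exp (-a * (s⁻¹ - 1)) := by ring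
    _ ≤ _ := add_le_add (pow_mul_exp_neg_le n ha hq) (pow_mul_exp_neg_le (n + 1) ha hq)

lemma integral_exp_neg_mul_Ioi {x : ℝ} (hx : 0 < x) :
    ∫ t in Ioi (0 : ℝ), Real.exp (-x * t) = 1 / x := by
  rw [integral_exp_mul_Ioi (by linarith)]
  simp

lemma integrableOn_mul_exp_neg_mul_Ioi {x : ℝ} (hx : 0 < x) :
    IntegrableOn (fun t => t * Real.exp (-x * t)) (Ioi 0) := by
  have := integrableOn_rpow_mul_exp_neg_mul_rpow (s := 1) (p := 1) (b := x) (by norm_num)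
    (by norm_num) hx
  simpa only [Real.rpow_one] using this

lemma integral_mul_exp_neg_mul_Ioi {x : ℝ} (hx : 0 < x) :
    ∫ t in Ioi (0 : ℝ), t * Real.exp (-x * t) = 1 / x ^ 2 := by
  have := Real.integral_rpow_mul_exp_neg_mul_Ioi (a := 2) (r := x) two_pos hx
  norm_num at this
  simpa [neg_mul] using this

lemma integral_exp_mul_bernsteinKernel {s x : ℝ} (hs : s ∈ Icc (0 : ℝ) 1) (hx : 0 < x) :
    ∫ t in Ioi (0 : ℝ), Real.exp (-x * t) * bernsteinKernel s t =
      1 / (x * (s * x + 1 - s)) := by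
  unfold bernsteinKernel
  split_ifs with h0 h1
  · simp only [mul_one, integral_exp_neg_mul_Ioi hx, h0]; simp
  · simp_rw [mul_comm (Real.exp _)]
    rw [integral_mul_exp_neg_mul_Ioi hx, h1]
    ring_nf
  have hs0 : 0 < s := lt_of_le_of_ne hs.1 (Ne.symm h0)
  have hs1 : 0 < 1 - s := sub_pos.2 (lt_of_le_of_ne hs.2 h1)
  have hq : 0 ≤ s⁻¹ - 1 := sub_nonneg.2 ((one_le_inv₀ hs0).2 hs.2)
  have h2 : ∀ t, Real.exp (-x * t) * ((1 - Real.exp (-t * (s⁻¹ - 1))) / (1 - s)) =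
      (Real.exp (-x * t) - Real.exp (-(x + (s⁻¹ - 1)) * t)) / (1 - s) := fun t => by
    rw [mul_div_assoc', mul_sub, mul_one, ← Real.exp_add]
    ring_nf
  simp_rw [h2]
  rw [integral_div, integral_sub (integrableOn_exp_mul_Ioi (by linarith) 0)
    (integrableOn_exp_mul_Ioi (by linarith) 0), integral_exp_neg_mul_Ioi hx,
    integral_exp_neg_mul_Ioi (by linarith)]
  have h3 : s * x + 1 - s ≠ 0 := by nlinarith [mul_pos hs0 hx]
  have h4 : x + (s⁻¹ - 1) = (s * x + 1 - s) / s := by field_simp; ring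
  rw [h4]
  generalize hd : s * x + 1 - s = d at h3
  field_simp
  linarith

lemma integrable_bernsteinKernel (ν : FiniteMeasure unitInterval) {t : ℝ} (ht : 0 ≤ t) :
    Integrable (fun s : unitInterval => bernsteinKernel s t) (ν : Measure unitInterval) := by
  refine Integrable.of_bound (C := 2 * (1 + t)) ?_ (Eventually.of_forall fun s => ?_)
  · exact (measurable_bernsteinKernel.comp (f := fun s : unitInterval => ((s : ℝ), t))
      (by fun_prop)).aestronglyMeasurable
  · have := bernsteinKernel_mem s.2 ht
    rw [Real.norm_of_nonneg this.1]
    exact this.2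

lemma integrable_bernsteinKernelDeriv (ν : FiniteMeasure unitInterval) (n : ℕ) {t : ℝ}
    (ht : 0 < t) :
    Integrable (fun s : unitInterval => bernsteinKernelDeriv n s t)
      (ν : Measure unitInterval) := by
  refine Integrable.of_bound (C := n.factorial / t ^ n + (n + 1).factorial / t ^ (n + 1)) ?_
    (Eventually.of_forall fun s => ?_)
  · exact ((measurable_bernsteinKernelDeriv n t).comp
      measurable_subtype_coe).aestronglyMeasurable
  · have := bernsteinKernelDeriv_mem n s.2 ht le_rfl
    rw [Real.norm_of_nonneg this.1]
    exact this.2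

lemma isBernstein_integral_bernsteinKernel (ν : FiniteMeasure unitInterval) :
    IsBernstein fun t => ∫ s : unitInterval, bernsteinKernel s t ∂(ν : Measure unitInterval) := by
  have hmeas : ∀ t, AEStronglyMeasurable (fun s : unitInterval => bernsteinKernel s t)
      (ν : Measure unitInterval) := fun t =>
    (measurable_bernsteinKernel.comp (f := fun s : unitInterval => ((s : ℝ), t))
      (by fun_prop)).aestronglyMeasurable
  have hmeas' : ∀ n t, AEStronglyMeasurable (fun s : unitInterval => bernsteinKernelDeriv n s t)
      (ν : Measure unitInterval) := fun n t =>
    ((measurable_bernsteinKernelDeriv n t).comp measurable_subtype_coe).aestronglyMeasurable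
  refine IsBernstein.of_hasDerivAt (G := fun n t => ∫ s : unitInterval,
    bernsteinKernelDeriv n s t ∂(ν : Measure unitInterval)) (fun t ht => ?_) (fun t ht => ?_)
    (fun t ht => ?_) (fun n t ht => ?_) fun n t ht => ?_
  · exact integral_nonneg fun s => (bernsteinKernel_mem s.2 ht).1
  · refine continuousWithinAt_of_dominated (bound := fun _ => 2 * (1 + (t + 1)))
      (Eventually.of_forall hmeas) ?_ (integrable_const _) (Eventually.of_forall fun s =>
        (continuous_bernsteinKernel s).continuousWithinAt)
    filter_upwards [self_mem_nhdsWithin, mem_nhdsWithin_of_mem_nhds (Iio_mem_nhds (lt_add_one t))]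
      with u hu hu'
    refine Eventually.of_forall fun s => ?_
    have := bernsteinKernel_mem s.2 hu
    rw [Real.norm_of_nonneg this.1]
    have := mem_Iio.1 hu'
    linarith [(bernsteinKernel_mem s.2 hu).2]
  · refine (hasDerivAt_integral_of_dominated_loc_of_deriv_le (Ioi_mem_nhds (half_lt_self ht))
      (bound := fun _ => Nat.factorial 0 / (t / 2) ^ 0 + (0 + 1).factorial / (t / 2) ^ (0 + 1))
      (Eventually.of_forall hmeas) (integrable_bernsteinKernel ν ht.le) (hmeas' 0 t)
      (Eventually.of_forall fun s u hu => ?_) (integrable_const _)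
      (Eventually.of_forall fun s u hu => hasDerivAt_bernsteinKernel s u)).2
    have := bernsteinKernelDeriv_mem 0 s.2 (half_pos ht) (mem_Ioi.1 hu).le
    rw [Real.norm_of_nonneg this.1]
    exact this.2
  · rw [← integral_neg]
    refine (hasDerivAt_integral_of_dominated_loc_of_deriv_le (Ioi_mem_nhds (half_lt_self ht))
      (bound := fun _ => (n + 1).factorial / (t / 2) ^ (n + 1) +
        (n + 1 + 1).factorial / (t / 2) ^ (n + 1 + 1))
      (Eventually.of_forall (hmeas' n)) (integrable_bernsteinKernelDeriv ν n ht)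
      (hmeas' (n + 1) t).neg
      (Eventually.of_forall fun s u hu => ?_) (integrable_const _)
      (Eventually.of_forall fun s u hu => hasDerivAt_bernsteinKernelDeriv n s u)).2
    have := bernsteinKernelDeriv_mem (n + 1) s.2 (half_pos ht) (mem_Ioi.1 hu).le
    rw [norm_neg, Real.norm_of_nonneg this.1]
    exact this.2
  · exact integral_nonneg fun s => (bernsteinKernelDeriv_mem n s.2 ht le_rfl).1

theorem HasMixtureRep.isCBF {ψ f : ℝ → ℝ} (h : HasMixtureRep ψ)
    (hf : ∀ x, 0 < x → f x = √x * ψ (Real.log x)) : IsCBF f := by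
  obtain ⟨ν, hν⟩ := h
  refine ⟨_, isBernstein_integral_bernsteinKernel ν, fun x hx => ?_⟩
  have hint : Integrable (Function.uncurry fun t (s : unitInterval) =>
      Real.exp (-x * t) * bernsteinKernel s t)
      ((volume.restrict (Ioi (0 : ℝ))).prod (ν : Measure unitInterval)) := by
    have hb : Integrable (fun p : ℝ × unitInterval =>
        (2 * (Real.exp (-x * p.1) + p.1 * Real.exp (-x * p.1))) * 1)
        ((volume.restrict (Ioi (0 : ℝ))).prod (ν : Measure unitInterval)) :=
      Integrable.mul_prod (f := fun t => 2 * (Real.exp (-x * t) + t * Real.exp (-x * t)))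
        (g := fun _ : unitInterval => (1 : ℝ))
        (((integrableOn_exp_mul_Ioi (by linarith) 0).add
          (integrableOn_mul_exp_neg_mul_Ioi hx)).const_mul 2) (integrable_const 1)
    refine hb.mono' ?_ ?_
    · refine Measurable.aestronglyMeasurable ?_
      exact (by fun_prop : Measurable fun p : ℝ × unitInterval => Real.exp (-x * p.1)).mul
        (measurable_bernsteinKernel.comp
          (f := fun p : ℝ × unitInterval => ((p.2 : ℝ), p.1)) (by fun_prop))
    · have : ∀ᵐ p : ℝ × unitInterval ∂((volume.restrict (Ioi (0 : ℝ))).prod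
          (ν : Measure unitInterval)), 0 < p.1 :=
        Measure.quasiMeasurePreserving_fst.ae (ae_restrict_mem measurableSet_Ioi)
      filter_upwards [this] with p hp
      have := bernsteinKernel_mem p.2.2 hp.le
      rw [Function.uncurry, norm_mul, Real.norm_of_nonneg (Real.exp_pos _).le,
        Real.norm_of_nonneg this.1]
      have := mul_le_mul_of_nonneg_left this.2 (Real.exp_pos (-x * p.1)).le
      linarith
  have h1 : ∀ t, Real.exp (-x * t) * ∫ s : unitInterval, bernsteinKernel s t
      ∂(ν : Measure unitInterval) = ∫ s : unitInterval, Real.exp (-x * t) * bernsteinKernel s t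
      ∂(ν : Measure unitInterval) := fun t => (integral_const_mul _ _).symm
  simp_rw [h1]
  rw [integral_integral_swap hint, hf x hx, hν, ← integral_const_mul, ← integral_const_mul]
  refine integral_congr_ae (Eventually.of_forall fun s => ?_)
  simp only [integral_exp_mul_bernsteinKernel s.2 hx, lineKernel]
  rw [Real.exp_neg, Real.exp_half, Real.exp_log hx]
  have hx' := Real.sqrt_pos.2 hx
  have h2 : s * √x + (1 - s) * (√x)⁻¹ = (s * x + 1 - s) / √x := by
    field_simp
    rw [Real.sq_sqrt hx.le]
    ring
  rw [h2, inv_div, mul_div_assoc', Real.mul_self_sqrt hx.le]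
  field_simp

/-- The left shift of real sequences. -/
abbrev seqShift : Module.End ℝ (ℕ → ℝ) := LinearMap.funLeft ℝ ℝ Nat.succ

/-- The operator `a ↦ (a k - a (k + 1))`. -/
abbrev seqDiff : Module.End ℝ (ℕ → ℝ) := 1 - seqShift

lemma seqShift_pow_apply (j : ℕ) (a : ℕ → ℝ) (k : ℕ) : (seqShift ^ j) a k = a (k + j) := by
  induction j generalizing a with
  | zero => simp
  | succ j ih =>
    rw [pow_succ, Module.End.mul_apply, ih]
    simp [LinearMap.funLeft_apply, add_assoc]

/-- The coefficients of the Hausdorff moment problem for the moment sequence `a`. -/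
noncomputable def hausdorffCoeff (a : ℕ → ℝ) (N m : ℕ) : ℝ :=
  N.choose m * (seqDiff ^ (N - m)) a m

lemma sum_choose_mul_diff (a : ℕ → ℝ) (n k : ℕ) :
    ∑ j ∈ Finset.range (n + 1), n.choose j * (seqDiff ^ (n - j)) a (k + j) = a k := by
  have hcomm : Commute seqShift seqDiff :=
    (Commute.one_right _).sub_right (Commute.refl _)
  have h := congrArg (fun T : Module.End ℝ (ℕ → ℝ) => T a k) (hcomm.add_pow n)
  simp only [add_sub_cancel, one_pow, Module.End.one_apply, LinearMap.sum_apply,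
    Finset.sum_apply] at h
  rw [h]
  refine Finset.sum_congr rfl fun j _ => ?_
  rw [← Nat.cast_comm, Module.End.mul_apply, Module.End.natCast_apply, Pi.smul_apply,
    Module.End.mul_apply, seqShift_pow_apply, nsmul_eq_mul]

lemma sum_hausdorffCoeff_mul (a : ℕ → ℝ) {N k : ℕ} (hk : k ≤ N) :
    ∑ m ∈ Finset.range (N + 1), hausdorffCoeff a N m * (m.choose k / N.choose k : ℝ) = a k := by
  have hN : (N.choose k : ℝ) ≠ 0 := Nat.cast_ne_zero.2 (Nat.choose_pos hk).ne'
  rw [← sum_choose_mul_diff a (N - k) k]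
  have h1 : N + 1 = k + (N - k + 1) := by omega
  rw [h1, Finset.sum_range_add, Finset.sum_eq_zero, zero_add]
  · refine Finset.sum_congr rfl fun j hj => ?_
    have hj' : k + j ≤ N := by have := Finset.mem_range.1 hj; omega
    have h2 : (N.choose (k + j) : ℝ) * (k + j).choose k = N.choose k * (N - k).choose j := by
      have := Nat.choose_mul (n := N) (k := k + j) (s := k) (by omega)
      rw [Nat.add_sub_cancel_left] at this
      exact_mod_cast this
    have h3 : N - (k + j) = N - k - j := by omega
    rw [hausdorffCoeff, h3]
    field_simp
    linear_combination (seqDiff ^ (N - k - j)) a (k + j) * h2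
  · intro m hm
    rw [Nat.choose_eq_zero_of_lt (Finset.mem_range.1 hm)]
    simp

lemma abs_choose_div_choose_sub_pow_le {N m k : ℕ} (hm : m ≤ N) (hk : 2 * k ≤ N) (hN : 0 < N) :
    |(m.choose k / N.choose k : ℝ) - (m / N : ℝ) ^ k| ≤ 2 * k ^ 2 / N := by
  have hN' : (0 : ℝ) < N := Nat.cast_pos.2 hN
  have hm' : (m : ℝ) ≤ N := Nat.cast_le.2 hm
  have hrw : ∀ k, (m.choose k / N.choose k : ℝ) = m.descFactorial k / N.descFactorial k := by
    intro k
    rw [Nat.descFactorial_eq_factorial_mul_choose, Nat.descFactorial_eq_factorial_mul_choose]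
    push_cast
    rw [mul_div_mul_left _ _ (by positivity)]
  rw [hrw]
  induction k with
  | zero => simp
  | succ k ih =>
    have ih := ih (by omega)
    have hd : (0 : ℝ) < N.descFactorial k := by
      exact_mod_cast Nat.descFactorial_pos.2 (by omega)
    have hkN : (2 : ℝ) * (k + 1) ≤ N := by exact_mod_cast hk
    have hNk : (0 : ℝ) < N - k := by linarith
    rw [Nat.descFactorial_succ, Nat.descFactorial_succ, Nat.cast_mul, Nat.cast_mul,
      mul_div_mul_comm, Nat.cast_sub (show k ≤ N by omega), pow_succ']
    set P : ℝ := m.descFactorial k / N.descFactorial k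
    have hP0 : 0 ≤ P := by positivity
    have hP1 : P ≤ 1 := (div_le_one hd).2 (Nat.cast_le.2 (Nat.descFactorial_le k hm))
    have hy0 : (0 : ℝ) ≤ m / N := by positivity
    have hy1 : (m / N : ℝ) ≤ 1 := (div_le_one hN').2 hm'
    have hx : |((m - k : ℕ) : ℝ) / (N - k) - m / N| ≤ 2 * k / N := by
      rcases le_total k m with h | h
      · rw [Nat.cast_sub h, div_sub_div _ _ hNk.ne' hN'.ne', abs_div,
          abs_of_pos (mul_pos hNk hN'), div_le_div_iff₀ (mul_pos hNk hN') hN']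
        have h1 : ((m : ℝ) - k) * N - (N - k) * m = -(k * (N - m)) := by ring
        have h2 : (0 : ℝ) ≤ k * (N - m) := mul_nonneg (Nat.cast_nonneg _) (by linarith)
        rw [h1, abs_neg, abs_of_nonneg h2]
        have h3 : (k : ℝ) * (N - m) ≤ 2 * k * (N - k) := by
          have := Nat.cast_nonneg (α := ℝ) k
          have := Nat.cast_nonneg (α := ℝ) m
          nlinarith
        nlinarith
      · have hmk : (m : ℝ) ≤ k := Nat.cast_le.2 h
        rw [Nat.sub_eq_zero_of_le h, Nat.cast_zero, zero_div, zero_sub, abs_neg, abs_of_nonneg hy0]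
        gcongr
        have := Nat.cast_nonneg (α := ℝ) k
        linarith
    calc |((m - k : ℕ) : ℝ) / (N - k) * P - m / N * (m / N) ^ k|
        = |(((m - k : ℕ) : ℝ) / (N - k) - m / N) * P + m / N * (P - (m / N) ^ k)| := by
          congr 1; ring
      _ ≤ |((m - k : ℕ) : ℝ) / (N - k) - m / N| * P + m / N * |P - (m / N) ^ k| := by
          refine (abs_add_le _ _).trans ?_
          rw [abs_mul, abs_mul, abs_of_nonneg hP0, abs_of_nonneg hy0]
      _ ≤ 2 * k / N * 1 + 1 * (2 * k ^ 2 / N) := by gcongr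
      _ ≤ 2 * (k + 1 : ℕ) ^ 2 / N := by
          rw [mul_one, one_mul, ← add_div]
          gcongr
          push_cast
          have := Nat.cast_nonneg (α := ℝ) k
          nlinarith

lemma hausdorffCoeff_nonneg {a : ℕ → ℝ} (ha : ∀ l k, 0 ≤ (seqDiff ^ l) a k) (N m : ℕ) :
    0 ≤ hausdorffCoeff a N m := mul_nonneg (Nat.cast_nonneg _) (ha _ _)

lemma sum_hausdorffCoeff (a : ℕ → ℝ) (N : ℕ) :
    ∑ m ∈ Finset.range (N + 1), hausdorffCoeff a N m = a 0 := by
  simpa using sum_hausdorffCoeff_mul a N.zero_le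

lemma tendsto_sum_hausdorffCoeff_mul_pow {a : ℕ → ℝ}
    (ha : ∀ l k, 0 ≤ (seqDiff ^ l) a k) (k : ℕ) :
    Tendsto (fun N : ℕ => ∑ m ∈ Finset.range (N + 1), hausdorffCoeff a N m * (m / N : ℝ) ^ k)
      atTop (𝓝 (a k)) := by
  have hlim : Tendsto (fun N : ℕ => a 0 * (2 * k ^ 2 / N : ℝ)) atTop (𝓝 0) := by
    simpa using (tendsto_const_div_atTop_nhds_zero_nat (2 * k ^ 2 : ℝ)).const_mul (a 0)
  rw [tendsto_iff_norm_sub_tendsto_zero]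
  refine squeeze_zero' (Eventually.of_forall fun _ => norm_nonneg _) ?_ hlim
  filter_upwards [eventually_ge_atTop (2 * k), eventually_gt_atTop 0] with N hk hN
  rw [← sum_hausdorffCoeff_mul a (show k ≤ N by omega), ← Finset.sum_sub_distrib,
    ← sum_hausdorffCoeff a N, Finset.sum_mul]
  refine norm_sum_le_of_le _ fun m hm => ?_
  rw [← mul_sub, norm_mul, Real.norm_of_nonneg (hausdorffCoeff_nonneg ha N m), norm_sub_rev]
  exact mul_le_mul_of_nonneg_left (abs_choose_div_choose_sub_pow_le
    (Nat.lt_succ_iff.1 (Finset.mem_range.1 hm)) hk hN) (hausdorffCoeff_nonneg ha N m)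

lemma HasMixtureRep.add {ψ₁ ψ₂ : ℝ → ℝ} (h₁ : HasMixtureRep ψ₁) (h₂ : HasMixtureRep ψ₂) :
    HasMixtureRep fun v => ψ₁ v + ψ₂ v := by
  obtain ⟨ν₁, hν₁⟩ := h₁
  obtain ⟨ν₂, hν₂⟩ := h₂
  refine ⟨ν₁ + ν₂, fun v => ?_⟩
  rw [FiniteMeasure.toMeasure_add, integral_add_measure
    (integrable_unitInterval ν₁ (continuous_lineKernel v))
    (integrable_unitInterval ν₂ (continuous_lineKernel v)), ← hν₁, ← hν₂]

lemma hasMixtureRep_const_mul_lineKernel {c s : ℝ} (hc : 0 ≤ c) (hs : s ∈ Icc (0 : ℝ) 1) :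
    HasMixtureRep fun v => c * lineKernel v s := by
  simpa using HasMixtureRep.of_integral (μ := Measure.dirac ()) (q := fun _ => c)
    (s := fun _ => ⟨s, hs⟩) (integrable_const c) (fun _ => hc) measurable_const

lemma HasMixtureRep.sum {ι : Type*} (S : Finset ι) {ψ : ι → ℝ → ℝ}
    (h : ∀ i ∈ S, HasMixtureRep (ψ i)) : HasMixtureRep fun v => ∑ i ∈ S, ψ i v := by
  classical
  induction S using Finset.induction_on with
  | empty => simpa using hasMixtureRep_zero
  | insert i S hi ih =>
    simp_rw [Finset.sum_insert hi]
    exact (h i (Finset.mem_insert_self i S)).add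
      (ih fun j hj => h j (Finset.mem_insert_of_mem hj))

lemma exp_half_mul_one_div_add (v : ℝ) {q : ℝ} (hq : 0 ≤ q) :
    Real.exp (v / 2) * (1 / (Real.exp v + q)) = 1 / (1 + q) * lineKernel v (1 / (1 + q)) := by
  have h1 : 0 < 1 + q := by linarith
  have h2 := Real.exp_pos (v / 2)
  have h3 : Real.exp v = Real.exp (v / 2) ^ 2 := by rw [← Real.exp_nat_mul]; ring_nf
  rw [lineKernel, Real.exp_neg, h3]
  generalize Real.exp (v / 2) = y at h2
  have h4 : 1 / (1 + q) * y + (1 - 1 / (1 + q)) * y⁻¹ = (y ^ 2 + q) / ((1 + q) * y) := by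
    field_simp
    ring
  rw [h4]
  field_simp

lemma hasMixtureRep_laplace_rpow {c r η : ℝ} (hc : 0 ≤ c) (hr : r ∈ Icc (0 : ℝ) 1) (hη : 0 < η) :
    HasMixtureRep fun v => Real.exp (v / 2) * ∫ t in Ioi (0 : ℝ),
      Real.exp (-Real.exp v * t) * (c * r ^ (t / η)) := by
  rcases hr.1.eq_or_lt with h0 | h0
  · convert hasMixtureRep_zero using 2 with v
    rw [setIntegral_eq_zero_of_forall_eq_zero, mul_zero]
    intro t ht
    rw [← h0, Real.zero_rpow (div_pos ht hη).ne', mul_zero, mul_zero]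
  have hq : 0 ≤ -Real.log r / η := div_nonneg (neg_nonneg.2 (Real.log_nonpos hr.1 hr.2)) hη.le
  convert hasMixtureRep_const_mul_lineKernel (c := c * (1 / (1 + -Real.log r / η)))
    (s := 1 / (1 + -Real.log r / η)) (by positivity)
    ⟨by positivity, (div_le_one (by linarith)).2 (by linarith)⟩ using 2 with v
  rw [mul_assoc, ← exp_half_mul_one_div_add v hq, mul_left_comm]
  have hx := Real.exp_pos v
  rw [← integral_exp_neg_mul_Ioi (by linarith : 0 < Real.exp v + -Real.log r / η),
    ← integral_const_mul c]
  congr 1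
  refine setIntegral_congr_fun measurableSet_Ioi fun t _ => ?_
  rw [mul_left_comm, Real.rpow_def_of_pos h0, ← Real.exp_add]
  ring_nf

lemma tendsto_of_antitoneOn_mesh {φ : ℝ → ℝ} {ψ : ℕ → ℝ → ℝ} (hφ : ContinuousOn φ (Ioi 0))
    (hψ : ∀ n, 0 < n → AntitoneOn (ψ n) (Ici 0))
    (happ : ∀ n : ℕ, 0 < n → ∀ k ≤ n ^ 2, |ψ n (k / n) - φ (k / n)| ≤ 1 / n) {t : ℝ}
    (ht : 0 < t) : Tendsto (fun n => ψ n t) atTop (𝓝 (φ t)) := by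
  have hcast : Tendsto (fun n : ℕ => (n : ℝ)) atTop atTop := tendsto_natCast_atTop_atTop
  have hinv : Tendsto (fun n : ℕ => 1 / (n : ℝ)) atTop (𝓝 0) := tendsto_one_div_atTop_nhds_zero_nat
  have hfl : Tendsto (fun n : ℕ => (⌊t * n⌋₊ / n : ℝ)) atTop (𝓝 t) :=
    (tendsto_nat_floor_mul_div_atTop ht.le).comp hcast
  have hfl' : Tendsto (fun n : ℕ => ((⌊t * n⌋₊ + 1 : ℕ) / n : ℝ)) atTop (𝓝 t) := by
    have := hfl.add hinv
    rw [add_zero] at this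
    refine this.congr fun n => ?_
    push_cast
    ring
  have hcont : ContinuousAt φ t := hφ.continuousAt (Ioi_mem_nhds ht)
  have hup := (hcont.tendsto.comp hfl).add hinv
  have hlo := (hcont.tendsto.comp hfl').sub hinv
  rw [add_zero] at hup
  rw [sub_zero] at hlo
  have hk : ∀ᶠ n : ℕ in atTop, 0 < n ∧ ⌊t * n⌋₊ + 1 ≤ n ^ 2 := by
    filter_upwards [eventually_gt_atTop 0, hcast.eventually_ge_atTop (t + 1)] with n hn hn'
    refine ⟨hn, ?_⟩
    have h1 : (⌊t * n⌋₊ : ℝ) ≤ t * n := Nat.floor_le (by positivity)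
    have h2 : (1 : ℝ) ≤ n := by exact_mod_cast hn
    have : ((⌊t * n⌋₊ + 1 : ℕ) : ℝ) ≤ (n ^ 2 : ℕ) := by push_cast; nlinarith
    exact_mod_cast this
  refine tendsto_of_tendsto_of_tendsto_of_le_of_le' hlo hup ?_ ?_
  · filter_upwards [hk] with n hn
    have hn0 : (0 : ℝ) < n := by exact_mod_cast hn.1
    have h1 := (abs_le.1 (happ n hn.1 _ hn.2)).1
    have h2 : t ≤ ((⌊t * n⌋₊ + 1 : ℕ) / n : ℝ) := by
      rw [le_div_iff₀ hn0]
      push_cast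
      exact (Nat.lt_floor_add_one _).le
    have h3 := hψ n hn.1 ht.le (ht.le.trans h2) h2
    simp only [Function.comp_apply]
    linarith
  · filter_upwards [hk] with n hn
    have hn0 : (0 : ℝ) < n := by exact_mod_cast hn.1
    have h1 := (abs_le.1 (happ n hn.1 ⌊t * n⌋₊ (by omega))).2
    have h2 : (⌊t * n⌋₊ / n : ℝ) ≤ t := by
      rw [div_le_iff₀ hn0]
      exact Nat.floor_le (by positivity)
    have h3 := hψ n hn.1 (show (0 : ℝ) ≤ ⌊t * n⌋₊ / n by positivity) ht.le h2
    simp only [Function.comp_apply]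
    linarith

lemma HasMixtureRep.laplace_of_seqDiff_nonneg {φ : ℝ → ℝ} (hφ : ContinuousOn φ (Ioi 0))
    (hdiff : ∀ η > 0, ∀ l k, 0 ≤ (seqDiff ^ l) (fun j : ℕ => φ (j * η)) k) :
    HasMixtureRep fun v => Real.exp (v / 2) * ∫ t in Ioi (0 : ℝ),
      Real.exp (-Real.exp v * t) * φ t := by
  let a : ℕ → ℕ → ℝ := fun n j => φ (j * (1 / n))
  let P : ℕ → ℕ → ℝ → ℝ := fun n N t =>
    ∑ m ∈ Finset.range (N + 1), hausdorffCoeff (a n) N m * (m / N : ℝ) ^ (t / (1 / n))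
  have ha : ∀ n : ℕ, 0 < n → ∀ l k, 0 ≤ (seqDiff ^ l) (a n) k := fun n hn =>
    hdiff _ (by positivity)
  have happ : ∀ n : ℕ, ∃ N, 0 < n → ∀ k ≤ n ^ 2, |P n N (k / n) - φ (k / n)| ≤ 1 / n := by
    intro n
    rcases n.eq_zero_or_pos with rfl | hn
    · exact ⟨0, by simp⟩
    have hn' : (0 : ℝ) < n := by exact_mod_cast hn
    have : ∀ᶠ N in atTop, ∀ k ∈ Finset.range (n ^ 2 + 1),
        |P n N (k / n) - φ (k / n)| ≤ 1 / n := by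
      refine (Finset.range (n ^ 2 + 1)).eventually_all.2 fun k _ => ?_
      have h1 := (tendsto_sum_hausdorffCoeff_mul_pow (ha n hn) k).sub_const (φ (k / n))
      have h2 : a n k - φ (k / n) = 0 := by simp [a, div_eq_mul_inv]
      rw [h2] at h1
      filter_upwards [h1.eventually (Metric.closedBall_mem_nhds 0 (one_div_pos.2 hn'))] with N hN
      have h3 : (k / n : ℝ) / (1 / n) = k := by field_simp
      rw [Real.dist_0_eq_abs] at hN
      simpa only [P, h3, Real.rpow_natCast] using hN
    obtain ⟨N, hN⟩ := this.exists
    exact ⟨N, fun _ k hk => hN k (Finset.mem_range.2 (by omega))⟩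
  choose N hN using happ
  have hmem : ∀ {M m : ℕ}, m ∈ Finset.range (M + 1) → (m / M : ℝ) ∈ Icc (0 : ℝ) 1 := fun hm =>
    ⟨by positivity, div_le_one_of_le₀ (by
      exact_mod_cast Nat.lt_succ_iff.1 (Finset.mem_range.1 hm)) (by positivity)⟩
  have hanti : ∀ n, 0 < n → AntitoneOn (P n (N n)) (Ici 0) := by
    intro n hn t ht u _ htu
    refine Finset.sum_le_sum fun m hm => mul_le_mul_of_nonneg_left ?_
      (hausdorffCoeff_nonneg (ha n hn) _ _)
    exact Real.rpow_le_rpow_of_exponent_ge' (hmem hm).1 (hmem hm).2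
      (div_nonneg ht (by positivity)) (by gcongr)
  have hbound : ∀ n, 0 < n → ∀ t, 0 ≤ t → ‖P n (N n) t‖ ≤ φ 0 := by
    intro n hn t ht
    have h1 : φ 0 = ∑ m ∈ Finset.range (N n + 1), hausdorffCoeff (a n) (N n) m := by
      rw [sum_hausdorffCoeff]
      simp [a]
    rw [h1]
    refine norm_sum_le_of_le _ fun m hm => ?_
    have h2 := Real.rpow_nonneg (hmem hm).1 (t / (1 / n))
    rw [Real.norm_of_nonneg (mul_nonneg (hausdorffCoeff_nonneg (ha n hn) _ _) h2)]
    exact mul_le_of_le_one_right (hausdorffCoeff_nonneg (ha n hn) _ _)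
      (Real.rpow_le_one (hmem hm).1 (hmem hm).2 (by positivity))
  have hint : ∀ {x : ℝ}, 0 < x → ∀ {b : ℝ} {F : ℝ → ℝ}, Measurable F →
      (∀ t, 0 ≤ t → ‖F t‖ ≤ b) → IntegrableOn (fun t => Real.exp (-x * t) * F t) (Ioi 0) := by
    intro x hx b F hF hb
    refine ((integrableOn_exp_mul_Ioi (neg_lt_zero.2 hx) 0).mul_const b).mono'
      (Measurable.aestronglyMeasurable (by fun_prop)) ?_
    filter_upwards [ae_restrict_mem measurableSet_Ioi] with t ht
    rw [norm_mul, Real.norm_of_nonneg (Real.exp_pos _).le]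
    exact mul_le_mul_of_nonneg_left (hb t (mem_Ioi.1 ht).le) (Real.exp_pos _).le
  have hmeas : ∀ n M, Measurable (P n M) := fun n M => by fun_prop
  refine HasMixtureRep.of_tendsto (l := atTop) (ψs := fun n v => Real.exp (v / 2) *
    ∫ t in Ioi (0 : ℝ), Real.exp (-Real.exp v * t) * P n (N n) t) ?_ fun v => ?_
  · filter_upwards [eventually_gt_atTop 0] with n hn
    convert HasMixtureRep.sum (Finset.range (N n + 1)) fun m hm =>
      hasMixtureRep_laplace_rpow (hausdorffCoeff_nonneg (ha n hn) (N n) m) (hmem hm)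
        (show (0 : ℝ) < 1 / n by positivity) using 2 with v
    rw [← Finset.mul_sum, ← integral_finsetSum]
    · simp only [P, Finset.mul_sum]
    · intro m hm
      refine hint (Real.exp_pos v) (b := hausdorffCoeff (a n) (N n) m) (by fun_prop) fun t ht => ?_
      have h2 := Real.rpow_nonneg (hmem hm).1 (t / (1 / n))
      rw [Real.norm_of_nonneg (mul_nonneg (hausdorffCoeff_nonneg (ha n hn) _ _) h2)]
      exact mul_le_of_le_one_right (hausdorffCoeff_nonneg (ha n hn) _ _)
        (Real.rpow_le_one (hmem hm).1 (hmem hm).2 (by positivity))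
  · refine (tendsto_integral_filter_of_dominated_convergence
      (fun t => Real.exp (-Real.exp v * t) * φ 0)
      (Eventually.of_forall fun n => Measurable.aestronglyMeasurable (by fun_prop)) ?_
      ((integrableOn_exp_mul_Ioi (neg_lt_zero.2 (Real.exp_pos v)) 0).mul_const _) ?_).const_mul _
    · filter_upwards [eventually_gt_atTop 0] with n hn
      filter_upwards [ae_restrict_mem measurableSet_Ioi] with t ht
      rw [norm_mul, Real.norm_of_nonneg (Real.exp_pos _).le]
      exact mul_le_mul_of_nonneg_left (hbound n hn t (mem_Ioi.1 ht).le) (Real.exp_pos _).le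
    · filter_upwards [ae_restrict_mem measurableSet_Ioi] with t ht
      exact (tendsto_of_antitoneOn_mesh hφ hanti hN ht).const_mul _

lemma antitoneOn_Ici_of_hasDerivAt_nonpos {u u' : ℝ → ℝ} {b : ℝ}
    (hu : ∀ t, b ≤ t → HasDerivAt u (-u' t) t) (hu' : ∀ t, b ≤ t → 0 ≤ u' t) :
    AntitoneOn u (Ici b) := by
  refine antitoneOn_of_hasDerivWithinAt_nonpos (convex_Ici b)
    (fun t ht => (hu t ht).continuousAt.continuousWithinAt)
    (fun t ht => (hu t (interior_subset ht)).hasDerivWithinAt) fun t ht => ?_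
  exact neg_nonpos.2 (hu' t (interior_subset ht))

lemma seqDiff_pow_nonneg_of_hasDerivAt {G : ℕ → ℝ → ℝ}
    (hG : ∀ n t, 0 ≤ t → HasDerivAt (G n) (-G (n + 1) t) t) (hG0 : ∀ n t, 0 ≤ t → 0 ≤ G n t)
    {η : ℝ} (hη : 0 < η) (l k : ℕ) : 0 ≤ (seqDiff ^ l) (fun j : ℕ => G 0 (j * η)) k := by
  induction l generalizing G with
  | zero => simpa using hG0 0 (k * η) (by positivity)
  | succ l ih =>
    have h1 : seqDiff (fun j : ℕ => G 0 (j * η)) =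
        fun j : ℕ => G 0 (j * η) - G 0 (j * η + η) := by
      ext j
      simp [LinearMap.funLeft_apply, add_mul]
    rw [pow_succ, Module.End.mul_apply, h1]
    refine ih (G := fun n t => G n t - G n (t + η)) (fun n t ht => ?_) fun n t ht => ?_
    · refine ((hG n t ht).sub ((hG n (t + η) (by positivity)).comp_add_const t η)).congr_deriv ?_
      ring
    · exact sub_nonneg.2 (antitoneOn_Ici_of_hasDerivAt_nonpos (hG n) (hG0 (n + 1)) ht
        (add_nonneg ht hη.le) (by linarith))

lemma IsBernstein.exists_hasDerivAt {g : ℝ → ℝ} (h : IsBernstein g) : ∃ G : ℕ → ℝ → ℝ,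
    (∀ t, 0 < t → HasDerivAt g (G 0 t) t) ∧
    (∀ n t, 0 < t → HasDerivAt (G n) (-G (n + 1) t) t) ∧ ∀ n t, 0 < t → 0 ≤ G n t := by
  obtain ⟨-, -, hsm, hder⟩ := h
  have key : ∀ n t, 0 < t → HasDerivAt (iteratedDerivWithin n g (Ioi 0))
      (iteratedDerivWithin (n + 1) g (Ioi 0) t) t := by
    intro n t ht
    have h1 : DifferentiableOn ℝ (iteratedDerivWithin n g (Ioi 0)) (Ioi 0) :=
      hsm.differentiableOn_iteratedDerivWithin (by exact_mod_cast WithTop.coe_lt_top n)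
        (uniqueDiffOn_Ioi 0)
    rw [iteratedDerivWithin_succ, derivWithin_of_isOpen isOpen_Ioi ht]
    exact ((h1 t ht).differentiableAt (Ioi_mem_nhds ht)).hasDerivAt
  refine ⟨fun n t => (-1) ^ n * iteratedDerivWithin (n + 1) g (Ioi 0) t, fun t ht => ?_,
    fun n t ht => ?_, fun n t ht => ?_⟩
  · simpa using key 0 t ht
  · refine ((key (n + 1) t ht).const_mul _).congr_deriv ?_
    ring
  · simpa using hder (n + 1) (by omega) t ht

lemma IsBernstein.monotoneOn_s6 {g : ℝ → ℝ} (h : IsBernstein g) : MonotoneOn g (Ici 0) := by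
  obtain ⟨G, hg, -, hG0⟩ := h.exists_hasDerivAt
  refine monotoneOn_of_hasDerivWithinAt_nonneg (convex_Ici 0) h.2.1
    (fun t ht => (hg t (by simpa using ht)).hasDerivWithinAt) fun t ht => ?_
  exact hG0 0 t (by simpa using ht)

lemma IsBernstein.exists_le_affine {g : ℝ → ℝ} (h : IsBernstein g) :
    ∃ A B : ℝ, 0 ≤ B ∧ ∀ t, 0 ≤ t → g t ≤ A + B * t := by
  obtain ⟨G, hg, hG, hG0⟩ := h.exists_hasDerivAt
  refine ⟨g 1, G 0 1, hG0 0 1 one_pos, fun t ht => ?_⟩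
  rcases le_total t 1 with ht1 | ht1
  · have h1 := h.monotoneOn_s6 ht (mem_Ici.2 zero_le_one) ht1
    have h2 := mul_nonneg (hG0 0 1 one_pos) ht
    linarith
  · have hanti : AntitoneOn (G 0) (Ici 1) :=
      antitoneOn_Ici_of_hasDerivAt_nonpos (fun t ht => hG 0 t (zero_lt_one.trans_le ht))
        fun t ht => hG0 1 t (zero_lt_one.trans_le ht)
    have h1 := antitoneOn_Ici_of_hasDerivAt_nonpos (u := fun t => g t - G 0 1 * t)
      (u' := fun t => G 0 1 - G 0 t) (b := 1) (fun t ht => by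
        refine ((hg t (zero_lt_one.trans_le ht)).sub
          ((hasDerivAt_id' t).const_mul (G 0 1))).congr_deriv ?_
        ring) fun t ht => sub_nonneg.2 (hanti (self_mem_Ici) ht ht)
    have h2 := h1 self_mem_Ici (show t ∈ Ici 1 from ht1) ht1
    have h3 := hG0 0 1 one_pos
    simp only at h2
    linarith

lemma IsBernstein.integrableOn_exp_mul_comp_add {g : ℝ → ℝ} (h : IsBernstein g) {x : ℝ}
    (hx : 0 < x) {δ : ℝ} (hδ : 0 ≤ δ) :
    IntegrableOn (fun t => Real.exp (-x * t) * g (t + δ)) (Ioi 0) := by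
  obtain ⟨A, B, hB, hAB⟩ := h.exists_le_affine
  refine (((integrableOn_exp_mul_Ioi (neg_lt_zero.2 hx) 0).mul_const (A + B * δ)).add
    ((integrableOn_mul_exp_neg_mul_Ioi hx).const_mul B)).mono' ?_ ?_
  · refine ContinuousOn.aestronglyMeasurable (ContinuousOn.mul (by fun_prop)
      (h.2.1.comp (by fun_prop) fun t ht => ?_)) measurableSet_Ioi
    exact add_nonneg (mem_Ioi.1 ht).le hδ
  · filter_upwards [ae_restrict_mem measurableSet_Ioi] with t ht
    have ht' : 0 ≤ t + δ := add_nonneg (mem_Ioi.1 ht).le hδ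
    rw [norm_mul, Real.norm_of_nonneg (Real.exp_pos _).le, Real.norm_of_nonneg (h.1 _ ht')]
    have := mul_le_mul_of_nonneg_left (hAB _ ht') (Real.exp_pos (-x * t)).le
    simp only [Pi.add_apply]
    linarith

lemma IsBernstein.tendsto_exp_mul_comp_add {g : ℝ → ℝ} (h : IsBernstein g) {x : ℝ}
    (hx : 0 < x) {δ : ℝ} (hδ : 0 ≤ δ) :
    Tendsto (fun t => Real.exp (-x * t) * g (t + δ)) atTop (𝓝 0) := by
  obtain ⟨A, B, hB, hAB⟩ := h.exists_le_affine
  have h1 : Tendsto (fun t => t * Real.exp (-x * t)) atTop (𝓝 0) := by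
    simpa using tendsto_rpow_mul_exp_neg_mul_atTop_nhds_zero 1 x hx
  have h0 : Tendsto (fun t => Real.exp (-x * t)) atTop (𝓝 0) := by
    simpa using tendsto_rpow_mul_exp_neg_mul_atTop_nhds_zero 0 x hx
  have h2 := (h0.mul_const (A + B * δ)).add (h1.const_mul B)
  rw [zero_mul, mul_zero, add_zero] at h2
  refine squeeze_zero' ?_ ?_ h2
  · filter_upwards [eventually_ge_atTop 0] with t ht
    exact mul_nonneg (Real.exp_pos _).le (h.1 _ (add_nonneg ht hδ))
  · filter_upwards [eventually_ge_atTop 0] with t ht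
    have := mul_le_mul_of_nonneg_left (hAB _ (add_nonneg ht hδ)) (Real.exp_pos (-x * t)).le
    linarith

/-- The Laplace transform of a shifted Bernstein function in terms of that of its derivative. -/
lemma IsBernstein.mul_laplace_comp_add {g g' : ℝ → ℝ} (h : IsBernstein g)
    (hg : ∀ t, 0 < t → HasDerivAt g (g' t) t) (hanti : AntitoneOn g' (Ioi 0))
    (hg'0 : ∀ t, 0 < t → 0 ≤ g' t) (hg'c : ContinuousOn g' (Ioi 0)) {x : ℝ} (hx : 0 < x)
    {δ : ℝ} (hδ : 0 < δ) :
    x * ∫ t in Ioi (0 : ℝ), Real.exp (-x * t) * g (t + δ) =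
      g δ + ∫ t in Ioi (0 : ℝ), Real.exp (-x * t) * g' (t + δ) := by
  have hint := h.integrableOn_exp_mul_comp_add hx hδ.le
  have hint' : IntegrableOn (fun t => Real.exp (-x * t) * g' (t + δ)) (Ioi 0) := by
    refine ((integrableOn_exp_mul_Ioi (neg_lt_zero.2 hx) 0).mul_const (g' δ)).mono' ?_ ?_
    · refine ContinuousOn.aestronglyMeasurable (ContinuousOn.mul (by fun_prop)
        (hg'c.comp (by fun_prop) fun t ht => ?_)) measurableSet_Ioi
      exact add_pos (mem_Ioi.1 ht) hδ
    · filter_upwards [ae_restrict_mem measurableSet_Ioi] with t ht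
      have ht' : 0 < t + δ := add_pos (mem_Ioi.1 ht) hδ
      rw [norm_mul, Real.norm_of_nonneg (Real.exp_pos _).le, Real.norm_of_nonneg (hg'0 _ ht')]
      exact mul_le_mul_of_nonneg_left (hanti hδ ht' (by linarith [mem_Ioi.1 ht]))
        (Real.exp_pos _).le
  have h1 := integral_Ioi_of_hasDerivAt_of_tendsto' (a := 0)
    (f := fun t => Real.exp (-x * t) * g (t + δ))
    (f' := fun t => Real.exp (-x * t) * g' (t + δ) - x * (Real.exp (-x * t) * g (t + δ)))
    (fun t ht => by
      refine ((((hasDerivAt_id' t).const_mul (-x)).exp).mul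
        ((hg (t + δ) (add_pos_of_nonneg_of_pos ht hδ)).comp_add_const t δ)).congr_deriv ?_
      ring)
    (hint'.sub (hint.const_mul x)) (h.tendsto_exp_mul_comp_add hx hδ.le)
  rw [integral_sub hint' (hint.const_mul x), integral_const_mul] at h1
  simp only [mul_zero, Real.exp_zero, one_mul, zero_add, zero_sub] at h1
  linarith

theorem IsCBF.hasMixtureRep {f : ℝ → ℝ} (h : IsCBF f) :
    HasMixtureRep fun v => Real.exp (-(v / 2)) * f (Real.exp v) := by
  obtain ⟨g, hB, hf⟩ := h
  obtain ⟨G, hg, hG, hG0⟩ := hB.exists_hasDerivAt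
  have hcont : ContinuousOn (G 0) (Ioi 0) := fun t ht =>
    (hG 0 t ht).continuousAt.continuousWithinAt
  have hanti : AntitoneOn (G 0) (Ioi 0) := fun t ht u _ htu =>
    antitoneOn_Ici_of_hasDerivAt_nonpos (fun r hr => hG 0 r (lt_of_lt_of_le ht hr))
      (fun r hr => hG0 1 r (lt_of_lt_of_le ht hr)) self_mem_Ici htu htu
  refine HasMixtureRep.of_tendsto (l := 𝓝[>] (0 : ℝ)) (ψs := fun δ v => Real.exp (-(v / 2)) *
    (Real.exp v ^ 2 * ∫ t in Ioi (0 : ℝ), Real.exp (-Real.exp v * t) * g (t + δ))) ?_ fun v => ?_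
  · filter_upwards [self_mem_nhdsWithin] with δ (hδ : 0 < δ)
    have hpos : ∀ {t : ℝ}, 0 ≤ t → 0 < t + δ := fun ht => add_pos_of_nonneg_of_pos ht hδ
    have h1 : HasMixtureRep fun v => Real.exp (v / 2) * ∫ t in Ioi (0 : ℝ),
        Real.exp (-Real.exp v * t) * G 0 (t + δ) := by
      refine HasMixtureRep.laplace_of_seqDiff_nonneg (φ := fun t => G 0 (t + δ))
        (hcont.comp (by fun_prop) fun t ht => hpos (mem_Ioi.1 ht).le) fun η hη l k => ?_
      exact seqDiff_pow_nonneg_of_hasDerivAt (G := fun n t => G n (t + δ))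
        (fun n t ht => (hG n _ (hpos ht)).comp_add_const t δ) (fun n t ht => hG0 n _ (hpos ht))
        hη l k
    have h2 := hasMixtureRep_const_mul_lineKernel (s := 0) (hB.1 δ hδ.le)
      ⟨le_rfl, zero_le_one⟩
    convert h2.add h1 using 2 with v
    have h3 : Real.exp v = Real.exp (v / 2) ^ 2 := by rw [← Real.exp_nat_mul]; ring_nf
    rw [pow_two, mul_assoc, hB.mul_laplace_comp_add hg hanti (hG0 0) hcont (Real.exp_pos v) hδ,
      ← mul_assoc, ← Real.exp_add, lineKernel, Real.exp_neg]
    have h4 : -(v / 2) + v = v / 2 := by ring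
    rw [h4]
    simp
    ring
  · rw [hf _ (Real.exp_pos v)]
    refine Tendsto.const_mul _ (Tendsto.const_mul _ ?_)
    refine tendsto_integral_filter_of_dominated_convergence
      (fun t => Real.exp (-Real.exp v * t) * g (t + 1)) ?_ ?_
      (hB.integrableOn_exp_mul_comp_add (Real.exp_pos v) zero_le_one) ?_
    · filter_upwards [self_mem_nhdsWithin] with δ (hδ : 0 < δ)
      exact (hB.integrableOn_exp_mul_comp_add (Real.exp_pos v) hδ.le).1
    · filter_upwards [Ioo_mem_nhdsGT one_pos] with δ hδ
      filter_upwards [ae_restrict_mem measurableSet_Ioi] with t ht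
      have ht' : 0 ≤ t + δ := add_nonneg (mem_Ioi.1 ht).le hδ.1.le
      rw [norm_mul, Real.norm_of_nonneg (Real.exp_pos _).le, Real.norm_of_nonneg (hB.1 _ ht')]
      exact mul_le_mul_of_nonneg_left (hB.monotoneOn_s6 ht' (by
        have := mem_Ioi.1 ht
        exact (by linarith : (0 : ℝ) ≤ t + 1)) (by linarith [hδ.2])) (Real.exp_pos _).le
    · filter_upwards [ae_restrict_mem measurableSet_Ioi] with t ht
      refine Tendsto.const_mul _ (Tendsto.mono_left ?_ nhdsWithin_le_nhds)
      have h1 := (hg t ht).continuousAt.tendsto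
      have h2 : Tendsto (fun δ => t + δ) (𝓝 0) (𝓝 t) := by
        simpa using (continuous_const_add t).tendsto 0
      exact h1.comp h2

theorem isCBF_iff_hasMixtureRep {f : ℝ → ℝ} :
    IsCBF f ↔ HasMixtureRep fun v => Real.exp (-(v / 2)) * f (Real.exp v) := by
  refine ⟨IsCBF.hasMixtureRep, fun h => h.isCBF fun x hx => ?_⟩
  rw [← mul_assoc, Real.exp_neg, Real.exp_half, Real.exp_log hx,
    mul_inv_cancel₀ (Real.sqrt_pos.2 hx).ne', one_mul]

lemma IsCBF.nonneg {f : ℝ → ℝ} (h : IsCBF f) {x : ℝ} (hx : 0 < x) : 0 ≤ f x := by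
  obtain ⟨g, hg, hf⟩ := h
  rw [hf x hx]
  exact mul_nonneg (sq_nonneg x) (setIntegral_nonneg measurableSet_Ioi fun t ht =>
    mul_nonneg (Real.exp_pos _).le (hg.1 t (mem_Ioi.1 ht).le))

lemma exp_neg_half_mul_sqrt (v y : ℝ) :
    Real.exp (-(v / 2)) * √y = Real.exp (-(1 / 4) * v) * √(Real.exp (-(v / 2)) * y) := by
  rw [Real.sqrt_mul (Real.exp_pos _).le, ← Real.exp_half, ← mul_assoc, ← Real.exp_add]
  ring_nf

/-- Corollary: `𝔉 ∩ p^{1/2}𝔉 = p^{1/2}𝔉^{1/2}` — `f` is a complete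
Bernstein function of the form `p^{1/2} h(p)` with `h` a CBF, if and only if
`f(p) = p^{1/2} g(p)^{1/2}` for some CBF `g`. -/
theorem cbf_inter_sqrt_mul_cbf_eq_sqrt_mul_sqrt_cbf (f : ℝ → ℝ) :
    (IsCBF f ∧ ∃ h : ℝ → ℝ, IsCBF h ∧ ∀ p : ℝ, 0 < p → f p = Real.sqrt p * h p) ↔
    (∃ g : ℝ → ℝ, IsCBF g ∧ ∀ p : ℝ, 0 < p → f p = Real.sqrt p * Real.sqrt (g p)) := by
  constructor
  · rintro ⟨hf, h, hh, hfh⟩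
    refine ⟨fun p => h p ^ 2, ?_, fun p hp => by rw [hfh p hp, Real.sqrt_sq (hh.nonneg hp)]⟩
    rw [isCBF_iff_hasMixtureRep] at hf hh ⊢
    convert hh.exp_mul_sq ?_ using 2 with v
    · have h1 : Real.exp (-(v / 2)) = Real.exp (v / 2) * Real.exp (-(v / 2)) ^ 2 := by
        rw [← Real.exp_nat_mul, ← Real.exp_add]
        ring_nf
      linear_combination h (Real.exp v) ^ 2 * h1
    · convert hf using 2 with v
      rw [hfh _ (Real.exp_pos v), ← Real.exp_half]
      ring
  · rintro ⟨g, hg, hfg⟩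
    rw [isCBF_iff_hasMixtureRep] at hg
    refine ⟨isCBF_iff_hasMixtureRep.2 ?_, fun p => √(g p), isCBF_iff_hasMixtureRep.2 ?_, hfg⟩
    · convert hg.exp_mul_sqrt (c := 1 / 4) (by norm_num [abs_of_pos]) using 2 with v
      rw [hfg _ (Real.exp_pos v), ← Real.exp_half, mul_left_comm, exp_neg_half_mul_sqrt,
        ← mul_assoc, ← Real.exp_add]
      ring_nf
    · convert hg.exp_mul_sqrt (c := -(1 / 4)) (by norm_num [abs_of_pos])
        using 2 with v
      exact exp_neg_half_mul_sqrt v _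
end
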